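/- Bridge additivity: for δ, δ' ∈ D, x, y ≥ 0 and t > 0, the law of the sum of two independent generalized squared Bessel bridges Q^{δ,t}_{x→0} and Q^{δ',t}_{y→0} equals Q^{δ+δ',t}_{x+y→0}. -/

import Mathlib

open MeasureTheory ProbabilityTheory Filter

noncomputable section

/-- The path space `C(ℝ⁺, ℝ)` modelled as functions `ℝ → ℝ`. -/
abbrev RPath : Type := ℝ → ℝ

/-- The class `D` of nonnegative, measurable, locally bounded, piecewise
continuous functions. -/
def MemD (f : ℝ → ℝ) : Prop :=
  Measurable f ∧ (∀ t, 0 ≤ f t) ∧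
    (∀ T : ℝ, ∃ C : ℝ, ∀ t ∈ Set.Icc (0 : ℝ) T, f t ≤ C) ∧
    ∃ S : Set ℝ, S.Countable ∧ ∀ t ∉ S, ContinuousAt f t

/-- `W` is a standard Brownian motion with respect to the filtration `ℱ`:
it starts at `0`, has continuous paths, is adapted, has Gaussian increments
`W t - W s ∼ N(0, t - s)` that are independent of `ℱ s`. -/
structure IsBrownianMotion {Ω : Type*} [m : MeasurableSpace Ω] (P : Measure Ω)
    (ℱ : Filtration ℝ m) (W : ℝ → Ω → ℝ) : Prop where
  start : ∀ ω, W 0 ω = 0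
  cont : ∀ ω, Continuous fun t => W t ω
  adapted : Adapted ℱ W
  gaussian_increments : ∀ s t : ℝ, 0 ≤ s → s ≤ t →
    P.map (fun ω => W t ω - W s ω) = gaussianReal 0 (Real.toNNReal (t - s))
  indep_increments : ∀ s t : ℝ, 0 ≤ s → s ≤ t →
    Indep (MeasurableSpace.comap (fun ω => W t ω - W s ω) (borel ℝ)) (ℱ s) P

/-- `X` is a (strong) solution of the SDE `dX_t = b(t, X_t) dt + σ(X_t) dW_t`,
`X_0 = x`, formulated through the martingale problem relative to `W`:
`M_t := X_t - x - ∫_0^t b(s, X_s) ds` is a martingale, its quadratic variation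
is `∫_0^t σ(X_s)² ds`, and its covariation with `W` is `∫_0^t σ(X_s) ds`
(the latter characterizes `M_t = ∫_0^t σ(X_s) dW_s`). -/
structure IsSDESolution {Ω : Type*} [m : MeasurableSpace Ω] (P : Measure Ω)
    (ℱ : Filtration ℝ m) (W : ℝ → Ω → ℝ)
    (b : ℝ → ℝ → ℝ) (σ : ℝ → ℝ) (x : ℝ) (X : ℝ → Ω → ℝ) : Prop where
  init : ∀ ω, X 0 ω = x
  cont : ∀ ω, Continuous fun t => X t ω
  adapted : Adapted ℱ X
  drift_mart : Martingale
    (fun t ω => X t ω - x - ∫ s in Set.Ioc (0 : ℝ) t, b s (X s ω)) ℱ P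
  quad_var : Martingale
    (fun t ω => (X t ω - x - ∫ s in Set.Ioc (0 : ℝ) t, b s (X s ω)) ^ 2
      - ∫ s in Set.Ioc (0 : ℝ) t, (σ (X s ω)) ^ 2) ℱ P
  driven_by : Martingale
    (fun t ω => (X t ω - x - ∫ s in Set.Ioc (0 : ℝ) t, b s (X s ω)) * W t ω
      - ∫ s in Set.Ioc (0 : ℝ) t, σ (X s ω)) ℱ P

/-- The drift `(t, y) ↦ 2 β_t y + δ_t` of the generalized squared Bessel process. -/
def gbesqDrift (β δ : ℝ → ℝ) : ℝ → ℝ → ℝ := fun t y => 2 * β t * y + δ t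

/-- The diffusion coefficient `y ↦ 2 √y` of the squared Bessel process. -/
def besqSigma : ℝ → ℝ := fun y => 2 * Real.sqrt y

/-- `X` is a generalized squared Bessel process `GBESQ^{β,δ}_x` driven by `W`. -/
def IsGBESQ {Ω : Type*} [m : MeasurableSpace Ω] (P : Measure Ω)
    (ℱ : Filtration ℝ m) (W : ℝ → Ω → ℝ) (β δ : ℝ → ℝ) (x : ℝ)
    (X : ℝ → Ω → ℝ) : Prop :=
  IsSDESolution P ℱ W (gbesqDrift β δ) besqSigma x X

/-- The law on path space of a process `X`. -/
def pathLaw {Ω : Type*} [m : MeasurableSpace Ω] (P : Measure Ω)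
    (X : ℝ → Ω → ℝ) : Measure RPath :=
  P.map fun ω t => X t ω

/-- A realization of the generalized squared Bessel process `GBESQ^{β,δ}_x`
whose law on path space is `μ`. -/
structure GBESQRealization (β δ : ℝ → ℝ) (x : ℝ) (μ : Measure RPath) where
  (Ω : Type)
  [m : MeasurableSpace Ω]
  (P : Measure Ω)
  (ℱ : Filtration ℝ m)
  (W : ℝ → Ω → ℝ)
  (X : ℝ → Ω → ℝ)
  (prob : IsProbabilityMeasure P)
  (bm : IsBrownianMotion P ℱ W)
  (sol : IsGBESQ P ℱ W β δ x X)
  (law : μ = pathLaw P X)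

/-- `μ` is the law `{}^β Q^δ_x` of the generalized squared Bessel process with
drift function `β`, dimension function `δ` and initial value `x`. -/
def IsGBESQLaw (β δ : ℝ → ℝ) (x : ℝ) (μ : Measure RPath) : Prop :=
  Nonempty (GBESQRealization β δ x μ)

/-- Convolution of two laws on path space: the law of the pathwise sum of
independent copies. -/
def mconv (μ ν : Measure RPath) : Measure RPath :=
  (μ.prod ν).map fun p => p.1 + p.2

/-- `Q` is a regular conditional distribution family ("bridge family") for `μ`
given the value of the path at time `t`, weakly continuous in the endpoint. -/
def IsBridgeFamily (μ : Measure RPath) (t : ℝ) (Q : ℝ → Measure RPath) : Prop :=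
  (∀ y, IsProbabilityMeasure (Q y)) ∧
  (∀ y, Q y {f : RPath | f t = y} = 1) ∧
  (∀ φ : RPath → ℝ, Continuous φ → (∃ C, ∀ f, |φ f| ≤ C) →
    Continuous fun y => ∫ f, φ f ∂(Q y)) ∧
  ∀ A : Set RPath, MeasurableSet A → ∀ B : Set ℝ, MeasurableSet B →
    μ (A ∩ {f : RPath | f t ∈ B}) = ∫⁻ y in B, Q y A ∂(μ.map fun f => f t)

/-- `ρ` is the generalized squared Bessel bridge law `Q^{δ,t}_{x→y}`: the law of
the `GBESQ` of dimension `δ` started at `x` conditioned to be `y` at time `t`. -/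
def IsGBESQBridge (δ : ℝ → ℝ) (t x y : ℝ) (ρ : Measure RPath) : Prop :=
  ∃ (μ : Measure RPath) (Q : ℝ → Measure RPath),
    IsGBESQLaw (fun _ => 0) δ x μ ∧ IsBridgeFamily μ t Q ∧ ρ = Q y

lemma path_ext (μ ν : Measure RPath) [IsFiniteMeasure μ] [IsFiniteMeasure ν]
    (h : ∀ (I : Finset ℝ) (ξ : ℝ → ℝ),
      ∫ f, Complex.exp ((∑ r ∈ I, ξ r * f r : ℝ) * Complex.I) ∂μ
        = ∫ f, Complex.exp ((∑ r ∈ I, ξ r * f r : ℝ) * Complex.I) ∂ν) : μ = ν := by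
  have h1 : IsProjectiveLimit μ (fun I : Finset ℝ => μ.map I.restrict) := fun I => rfl
  refine h1.unique (fun I => ?_)
  symm
  refine Measure.ext_of_charFunDual (funext fun L => ?_)
  rw [charFunDual_apply, charFunDual_apply,
    integral_map (Finset.measurable_restrict I).aemeasurable (by fun_prop),
    integral_map (Finset.measurable_restrict I).aemeasurable (by fun_prop)]
  classical
  have key : ∀ f : RPath, L (I.restrict f) =
      ∑ r ∈ I, (if hr : r ∈ I then L (Pi.single ⟨r, hr⟩ 1) else 0) * f r := by
    intro f
    rw [← Finset.sum_coe_sort I]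
    have : I.restrict f = ∑ i : I, (f i) • (Pi.single i (1:ℝ) : I → ℝ) := by
      ext j
      simp [Finset.sum_apply, Pi.single_apply]
    rw [this, map_sum]
    refine Finset.sum_congr rfl fun i _ => ?_
    rw [map_smul]
    simp [mul_comm]
  simp_rw [key]
  exact h I _

lemma bridge_measurable {μ : Measure RPath} {t : ℝ} {Q : ℝ → Measure RPath}
    (hQ : IsBridgeFamily μ t Q) : Measurable Q := by
  obtain ⟨hp, -, hc, -⟩ := hQ
  have step1 : ∀ I : Finset ℝ, Measurable (fun y => (Q y).map I.restrict) := by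
    intro I
    have : ∀ y, IsProbabilityMeasure ((Q y).map I.restrict) := fun y =>
      Measure.isProbabilityMeasure_map (Finset.measurable_restrict I).aemeasurable
    refine Measurable.measure_of_isPiSystem_of_isProbabilityMeasure
      (S := {s : Set (I → ℝ) | IsClosed s}) ?_ isPiSystem_isClosed ?_
    · rw [← borel_eq_generateFrom_isClosed]; exact BorelSpace.measurable_eq
    · intro F hF
      have hF : IsClosed F := hF
      let δs : ℕ → ℝ := fun n => 1 / ((n:ℝ) + 1)
      have δpos : ∀ n, 0 < δs n := fun n => by positivity
      have δlim : Tendsto δs atTop (nhds 0) := tendsto_one_div_add_atTop_nhds_zero_nat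
      have hlim : ∀ y, Tendsto (fun n => ∫⁻ v, (thickenedIndicator (δpos n) F v : ENNReal)
          ∂((Q y).map I.restrict)) atTop (nhds ((Q y).map I.restrict F)) := by
        intro y
        exact tendsto_lintegral_thickenedIndicator_of_isClosed _ hF δpos δlim
      refine measurable_of_tendsto_metrizable (f := fun n y => ∫⁻ v, (thickenedIndicator (δpos n) F v : ENNReal)
          ∂((Q y).map I.restrict)) (fun n => ?_) (tendsto_pi_nhds.2 hlim)
      have : (fun y => ∫⁻ v, (thickenedIndicator (δpos n) F v : ENNReal) ∂((Q y).map I.restrict))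
          = fun y => ENNReal.ofReal (∫ f, (thickenedIndicator (δpos n) F (I.restrict f) : ℝ) ∂(Q y)) := by
        funext y
        rw [lintegral_map (by fun_prop) (Finset.measurable_restrict I),
          ofReal_integral_eq_lintegral_ofReal]
        · simp
        · refine Integrable.of_bound (C := 1) ?_ (ae_of_all _ fun f => ?_)
          · apply Measurable.aestronglyMeasurable
            have := Finset.measurable_restrict (X := fun _ : ℝ => ℝ) I
            fun_prop
          · simp only [Real.norm_eq_abs, NNReal.abs_eq]
            exact_mod_cast thickenedIndicator_le_one _ _ _
        · exact ae_of_all _ fun f => by positivity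
      rw [this]
      refine ENNReal.measurable_ofReal.comp (Continuous.measurable ?_)
      refine hc _ ?_ ⟨1, fun f => ?_⟩
      · have : Continuous (fun f : RPath => I.restrict f) := by
          unfold Finset.restrict; fun_prop
        fun_prop
      · simp only [NNReal.abs_eq]
        exact_mod_cast thickenedIndicator_le_one _ _ _
  refine Measurable.measure_of_isPiSystem_of_isProbabilityMeasure
    (S := measurableCylinders (fun _ : ℝ => ℝ)) generateFrom_measurableCylinders.symm
    isPiSystem_measurableCylinders ?_
  intro s hs
  rw [mem_measurableCylinders] at hs
  obtain ⟨I, S, hS, rfl⟩ := hs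
  have := (Measure.measurable_coe hS).comp (step1 I)
  convert this using 2 with y
  exact (Measure.map_apply (Finset.measurable_restrict I) hS).symm

lemma bridge_disint {μ : Measure RPath} {t : ℝ} {Q : ℝ → Measure RPath} [IsProbabilityMeasure μ]
    (hQ : IsBridgeFamily μ t Q) (φ : RPath → ℂ) (hφm : Measurable φ) (hb : ∀ f, ‖φ f‖ ≤ 1)
    (g : ℝ → ℝ) (hg : Measurable g) (hg0 : ∀ y, 0 ≤ g y) (hg1 : ∀ y, g y ≤ 1) :
    ∫ f, φ f * (g (f t) : ℂ) ∂μ = ∫ y, (∫ f, φ f ∂(Q y)) * (g y : ℂ) ∂(μ.map fun f => f t) := by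
  have hQm := bridge_measurable hQ
  obtain ⟨hp, -, hc, hd⟩ := hQ
  let κ : Kernel ℝ RPath := ⟨Q, hQm⟩
  have : IsMarkovKernel κ := ⟨fun y => hp y⟩
  have ht : Measurable (fun f : RPath => f t) := measurable_pi_apply t
  set ν := μ.map (fun f : RPath => f t) with hν
  have : IsProbabilityMeasure ν := Measure.isProbabilityMeasure_map ht.aemeasurable
  have hm : Measurable (fun f : RPath => (f t, f)) := ht.prodMk measurable_id
  have hcomp : μ.map (fun f => (f t, f)) = ν ⊗ₘ κ := by
    have : IsProbabilityMeasure (μ.map (fun f : RPath => (f t, f))) :=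
      Measure.isProbabilityMeasure_map hm.aemeasurable
    refine Measure.ext_prod fun {B A} hB hA => ?_
    rw [Measure.map_apply hm (hB.prod hA), Measure.compProd_apply_prod hB hA]
    refine Eq.trans ?_ (hd A hA B hB)
    congr 1
    ext f; simp [and_comm]
  have h_integ : Integrable (fun p : ℝ × RPath => φ p.2 * (g p.1 : ℂ)) (ν ⊗ₘ κ) := by
    refine Integrable.of_bound (C := 1) (by fun_prop) (ae_of_all _ fun p => ?_)
    rw [norm_mul, Complex.norm_real, Real.norm_of_nonneg (hg0 _)]
    exact mul_le_one₀ (hb _) (hg0 _) (hg1 _)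
  have h1 : ∫ f, φ f * (g (f t) : ℂ) ∂μ = ∫ p, φ p.2 * (g p.1 : ℂ) ∂(μ.map (fun f => (f t, f))) := by
    rw [integral_map hm.aemeasurable (by fun_prop)]
  rw [h1, hcomp, Measure.integral_compProd h_integ]
  refine integral_congr_ae (ae_of_all _ fun y => ?_)
  simp only
  rw [integral_mul_const]
  rfl

lemma bridge_approx {μ : Measure RPath} {t : ℝ} {Q : ℝ → Measure RPath} [IsProbabilityMeasure μ]
    (hQ : IsBridgeFamily μ t Q) (φ : RPath → ℂ) (hφm : Measurable φ) (hφ : Continuous φ)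
    (hb : ∀ f, ‖φ f‖ ≤ 1)
    (hpos : ∀ᵐ f ∂μ, 0 ≤ f t) (η : ℝ) (hη : 0 < η) :
    ∃ ε > 0, ∀ g : ℝ → ℝ, Measurable g → (∀ y, 0 ≤ g y) → (∀ y, g y ≤ 1) →
      (∀ y, ε < y → g y = 0) →
      ‖∫ f, φ f * (g (f t) : ℂ) ∂μ - (∫ f, φ f ∂(Q 0)) * ((∫ f, g (f t) ∂μ : ℝ) : ℂ)‖
        ≤ η * ∫ f, g (f t) ∂μ := by
  have hp := hQ.1
  have ht : Measurable (fun f : RPath => f t) := measurable_pi_apply t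
  have hqi : ∀ y, Integrable φ (Q y) := fun y =>
    Integrable.of_bound (C := 1) hφm.aestronglyMeasurable (ae_of_all _ hb)
  have hqc : Continuous (fun y => ∫ f, φ f ∂(Q y)) := by
    have : (fun y => ∫ f, φ f ∂(Q y)) = fun y => ((∫ f, (φ f).re ∂(Q y) : ℝ) : ℂ)
        + ((∫ f, (φ f).im ∂(Q y) : ℝ) : ℂ) * Complex.I := by
      funext y
      exact (integral_re_add_im (𝕜 := ℂ) (hqi y)).symm
    rw [this]
    have c1 := hQ.2.2.1 (fun f => (φ f).re) (by fun_prop)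
      ⟨1, fun f => (Complex.abs_re_le_norm _).trans (hb f)⟩
    have c2 := hQ.2.2.1 (fun f => (φ f).im) (by fun_prop)
      ⟨1, fun f => (Complex.abs_im_le_norm _).trans (hb f)⟩
    fun_prop
  obtain ⟨ε, hε, hε'⟩ := Metric.continuous_iff.1 hqc 0 η hη
  refine ⟨ε / 2, by positivity, fun g hg hg0 hg1 hgs => ?_⟩
  rw [bridge_disint hQ φ hφm hb g hg hg0 hg1]
  set ν := μ.map (fun f : RPath => f t) with hν
  have : IsProbabilityMeasure ν := Measure.isProbabilityMeasure_map ht.aemeasurable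
  have hgν : ∫ f, g (f t) ∂μ = ∫ y, g y ∂ν := by
    rw [hν, integral_map ht.aemeasurable (by fun_prop)]
  have hgi : Integrable g ν := Integrable.of_bound (C := 1) (by fun_prop)
    (ae_of_all _ fun y => by rw [Real.norm_of_nonneg (hg0 y)]; exact hg1 y)
  have hνpos : ∀ᵐ y ∂ν, 0 ≤ y := by
    rw [hν, ae_map_iff ht.aemeasurable measurableSet_Ici]; exact hpos
  rw [hgν, ← integral_complex_ofReal, ← integral_const_mul, ← integral_sub]
  · rw [← integral_const_mul]
    refine norm_integral_le_of_norm_le (hgi.const_mul η) ?_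
    filter_upwards [hνpos] with y hy
    rw [← sub_mul, norm_mul, Complex.norm_real, Real.norm_of_nonneg (hg0 _)]
    by_cases hy2 : ε / 2 < y
    · simp [hgs y hy2]
    · refine mul_le_mul_of_nonneg_right ?_ (hg0 y)
      have := hε' y (by rw [Real.dist_eq, sub_zero, abs_of_nonneg hy]; linarith)
      rw [dist_eq_norm] at this
      exact this.le
  · have hqm := hqc.measurable
    refine Integrable.of_bound (C := 1) (Measurable.aestronglyMeasurable (by fun_prop))
      (ae_of_all _ fun y => ?_)
    rw [norm_mul, Complex.norm_real, Real.norm_of_nonneg (hg0 _)]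
    refine mul_le_one₀ ?_ (hg0 _) (hg1 _)
    refine (norm_integral_le_of_norm_le (integrable_const 1) (ae_of_all _ hb)).trans ?_
    simp
  · exact (hgi.ofReal).const_mul _

lemma isProbabilityMeasure_mconv (μ ν : Measure RPath) [IsProbabilityMeasure μ]
    [IsProbabilityMeasure ν] : IsProbabilityMeasure (mconv μ ν) :=
  Measure.isProbabilityMeasure_map (measurable_fst.add measurable_snd).aemeasurable

lemma bridge_combine {μ₁ μ₂ μ₃ : Measure RPath} {t : ℝ} {Q₁ Q₂ Q₃ : ℝ → Measure RPath}
    [IsProbabilityMeasure μ₁] [IsProbabilityMeasure μ₂] [IsProbabilityMeasure μ₃]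
    (hQ₁ : IsBridgeFamily μ₁ t Q₁) (hQ₂ : IsBridgeFamily μ₂ t Q₂) (hQ₃ : IsBridgeFamily μ₃ t Q₃)
    (hpos₁ : ∀ᵐ f ∂μ₁, 0 ≤ f t) (hpos₂ : ∀ᵐ f ∂μ₂, 0 ≤ f t) (hpos₃ : ∀ᵐ f ∂μ₃, 0 ≤ f t)
    (hconv : mconv μ₁ μ₂ = μ₃) (hsupp : ∀ ε > 0, 0 < μ₃ {f | f t ≤ ε}) :
    mconv (Q₁ 0) (Q₂ 0) = Q₃ 0 := by
  have := hQ₁.1 0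
  have := hQ₂.1 0
  have := hQ₃.1 0
  have := isProbabilityMeasure_mconv (Q₁ 0) (Q₂ 0)
  have ht : Measurable (fun f : RPath => f t) := measurable_pi_apply t
  have hadd : Measurable (fun p : RPath × RPath => p.1 + p.2) := measurable_fst.add measurable_snd
  refine path_ext _ _ fun I ξ => ?_
  set φ : RPath → ℂ := fun f => Complex.exp ((∑ r ∈ I, ξ r * f r : ℝ) * Complex.I) with hφ
  have hφc : Continuous φ := by fun_prop
  have hφm : Measurable φ := by fun_prop
  have hb : ∀ f, ‖φ f‖ ≤ 1 := fun f => by rw [hφ]; simp only [Complex.norm_exp_ofReal_mul_I, le_refl]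
  have hφadd : ∀ a b, φ (a + b) = φ a * φ b := by
    intro a b
    simp only [hφ, ← Complex.exp_add, ← add_mul, ← Complex.ofReal_add, ← Finset.sum_add_distrib,
      Pi.add_apply, mul_add]
  have hq : ∀ (μ : Measure RPath) [IsProbabilityMeasure μ], ‖∫ f, φ f ∂μ‖ ≤ 1 := by
    intro μ _
    refine (norm_integral_le_of_norm_le (integrable_const 1) (ae_of_all _ hb)).trans ?_
    simp
  have hL : ∫ f, φ f ∂(mconv (Q₁ 0) (Q₂ 0)) = (∫ f, φ f ∂(Q₁ 0)) * ∫ f, φ f ∂(Q₂ 0) := by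
    rw [mconv, integral_map hadd.aemeasurable hφm.aestronglyMeasurable]
    simp_rw [hφadd]
    exact integral_prod_mul _ _
  rw [hL]
  set q₁ := ∫ f, φ f ∂(Q₁ 0)
  set q₂ := ∫ f, φ f ∂(Q₂ 0)
  set q₃ := ∫ f, φ f ∂(Q₃ 0)
  have hq₁ : ‖q₁‖ ≤ 1 := hq (Q₁ 0)
  refine eq_of_forall_dist_le fun η' hη' => ?_
  obtain ⟨η, hη, rfl⟩ : ∃ η > 0, η' = 3 * η := ⟨η' / 3, by positivity, by ring⟩
  obtain ⟨ε₁, hε₁, H₁⟩ := bridge_approx hQ₁ φ hφm hφc hb hpos₁ η hη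
  obtain ⟨ε₂, hε₂, H₂⟩ := bridge_approx hQ₂ φ hφm hφc hb hpos₂ η hη
  obtain ⟨ε₃, hε₃, H₃⟩ := bridge_approx hQ₃ φ hφm hφc hb hpos₃ η hη
  set ε := min ε₁ (min ε₂ ε₃) with hε
  have hε0 : 0 < ε := by positivity
  have e1 : ε ≤ ε₁ := min_le_left _ _
  have e2 : ε ≤ ε₂ := (min_le_right _ _).trans (min_le_left _ _)
  have e3 : ε ≤ ε₃ := (min_le_right _ _).trans (min_le_right _ _)
  set g : ℝ → ℝ := (Set.Iic ε).indicator 1 with hg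
  have hgm : Measurable g := measurable_one.indicator measurableSet_Iic
  have hg0 : ∀ y, 0 ≤ g y := fun y => Set.indicator_nonneg (fun _ _ => zero_le_one) y
  have hg1 : ∀ y, g y ≤ 1 := fun y => Set.indicator_le_self' (fun _ _ => zero_le_one) y
  have hgz : ∀ y, ε < y → g y = 0 := fun y hy => by
    rw [hg, Set.indicator_of_notMem]; simpa using hy
  set p := ∫ f, g (f t) ∂μ₃ with hp
  have hp0 : 0 < p := by
    have : (fun f : RPath => g (f t)) = {f : RPath | f t ≤ ε}.indicator 1 := by
      ext f; simp [hg, Set.indicator_apply]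
    rw [hp, this, integral_indicator_one (measurableSet_le ht measurable_const)]
    exact ENNReal.toReal_pos (hsupp ε hε0).ne' (measure_ne_top _ _)
  have A3 := H₃ g hgm hg0 hg1 (fun y hy => hgz y (e3.trans_lt hy))
  -- the mixture function
  set G : ℝ → ℝ := fun β => ∫ a, g (a t + β) ∂μ₁ with hG
  have hgb : ∀ y, ‖g y‖ ≤ 1 := fun y => by rw [Real.norm_of_nonneg (hg0 y)]; exact hg1 y
  have hGm : Measurable G := by
    have : StronglyMeasurable (fun p : ℝ × RPath => g (p.2 t + p.1)) := by
      apply Measurable.stronglyMeasurable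
      exact hgm.comp ((ht.comp measurable_snd).add measurable_fst)
    exact (this.integral_prod_right (ν := μ₁)).measurable
  have hG0 : ∀ y, 0 ≤ G y := fun y => integral_nonneg fun a => hg0 _
  have hG1 : ∀ y, G y ≤ 1 := fun y => by
    have := norm_integral_le_of_norm_le (μ := μ₁) (integrable_const 1)
      (ae_of_all _ fun a : RPath => hgb (a t + y))
    simp only [integral_const, measureReal_def, measure_univ, smul_eq_mul] at this
    exact (le_abs_self _).trans (by simpa using this)
  have hGz : ∀ y, ε₂ < y → G y = 0 := fun y hy => by
    refine integral_eq_zero_of_ae ?_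
    filter_upwards [hpos₁] with a ha
    exact hgz _ (by linarith)
  have A2 := H₂ G hGm hG0 hG1 hGz
  have hgint : Integrable (fun p : RPath × RPath => g (p.1 t + p.2 t)) (μ₁.prod μ₂) := by
    refine Integrable.of_bound (C := 1) (Measurable.aestronglyMeasurable ?_)
      (ae_of_all _ fun p => hgb _)
    exact hgm.comp ((ht.comp measurable_fst).add (ht.comp measurable_snd))
  have hp' : p = ∫ b, G (b t) ∂μ₂ := by
    have hgt : Measurable (fun f : RPath => g (f t)) := hgm.comp ht
    rw [hp, ← hconv, mconv, integral_map hadd.aemeasurable hgt.aestronglyMeasurable]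
    exact integral_prod_symm _ hgint
  have hφg : Integrable (fun p : RPath × RPath => φ p.1 * φ p.2 * (g (p.1 t + p.2 t) : ℂ))
      (μ₁.prod μ₂) := by
    refine Integrable.of_bound (C := 1) (Measurable.aestronglyMeasurable ?_)
      (ae_of_all _ fun p => ?_)
    · have : Measurable (fun p : RPath × RPath => g (p.1 t + p.2 t)) :=
        hgm.comp ((ht.comp measurable_fst).add (ht.comp measurable_snd))
      fun_prop
    · rw [norm_mul, norm_mul, Complex.norm_real]
      exact mul_le_one₀ (mul_le_one₀ (hb _) (norm_nonneg _) (hb _)) (norm_nonneg _) (hgb _)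
  set H : RPath → ℂ := fun b => ∫ a, φ a * (g (a t + b t) : ℂ) ∂μ₁ with hH
  have hE : ∫ f, φ f * (g (f t) : ℂ) ∂μ₃ = ∫ b, φ b * H b ∂μ₂ := by
    rw [← hconv, mconv, integral_map hadd.aemeasurable
      (Measurable.aestronglyMeasurable (by have := hgm.comp ht; fun_prop))]
    simp_rw [hφadd, Pi.add_apply]
    rw [integral_prod_symm _ hφg]
    refine integral_congr_ae (ae_of_all _ fun b => ?_)
    simp only [hH]
    rw [← integral_const_mul]
    refine integral_congr_ae (ae_of_all _ fun a => ?_)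
    simp only; ring
  have hHint : Integrable (fun b => φ b * H b) μ₂ := by
    have := hφg.integral_prod_right
    refine this.congr (ae_of_all _ fun b => ?_)
    simp only [hH]
    rw [← integral_const_mul]
    refine integral_congr_ae (ae_of_all _ fun a => ?_)
    simp only; ring
  have hGint : Integrable (fun b : RPath => G (b t)) μ₂ := by
    refine Integrable.of_bound (C := 1) (hGm.comp ht).aestronglyMeasurable
      (ae_of_all _ fun b => ?_)
    rw [Real.norm_of_nonneg (hG0 _)]; exact hG1 _
  have hφG : Integrable (fun b => φ b * (G (b t) : ℂ)) μ₂ := by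
    refine hGint.ofReal.bdd_mul (c := 1) hφm.aestronglyMeasurable (ae_of_all _ hb)
  have A1 : ‖(∫ b, φ b * H b ∂μ₂) - q₁ * ∫ b, φ b * (G (b t) : ℂ) ∂μ₂‖ ≤ η * p := by
    rw [hp', ← integral_const_mul, ← integral_sub hHint (hφG.const_mul _), ← integral_const_mul]
    refine norm_integral_le_of_norm_le (hGint.const_mul _) ?_
    filter_upwards [hpos₂] with b hbt
    have := H₁ (fun y => g (y + b t)) (hgm.comp (measurable_id.add_const _)) (fun _ => hg0 _)
      (fun _ => hg1 _) (fun y hy => hgz _ (by linarith))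
    have e : φ b * H b - q₁ * (φ b * (G (b t) : ℂ)) = φ b * (H b - q₁ * (G (b t) : ℂ)) := by ring
    rw [e, norm_mul]
    calc _ ≤ 1 * _ := mul_le_mul_of_nonneg_right (hb b) (norm_nonneg _)
      _ ≤ _ := by rw [one_mul]; exact this
  rw [← hp'] at A2
  have A2' : ‖q₁ * (∫ b, φ b * (G (b t) : ℂ) ∂μ₂) - q₁ * (q₂ * p)‖ ≤ η * p := by
    rw [← mul_sub, norm_mul]
    calc _ ≤ 1 * _ := mul_le_mul_of_nonneg_right hq₁ (norm_nonneg _)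
      _ ≤ _ := by rw [one_mul]; exact A2
  rw [hE] at A3
  have hfin : ‖q₁ * q₂ - q₃‖ * p ≤ 3 * η * p := by
    have : ‖q₁ * q₂ - q₃‖ * p = ‖q₁ * (q₂ * p) - q₃ * p‖ := by
      rw [show q₁ * (q₂ * (p:ℂ)) - q₃ * p = (q₁ * q₂ - q₃) * p by ring, norm_mul, Complex.norm_real,
        Real.norm_of_nonneg hp0.le]
    rw [this]
    set E := ∫ b, φ b * H b ∂μ₂
    set E' := ∫ b, φ b * (G (b t) : ℂ) ∂μ₂
    have t1 : q₁ * (q₂ * p) - q₃ * p = -((q₁ * E' - q₁ * (q₂ * p))) + (-(E - q₁ * E')) + (E - q₃ * p) := by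
      ring
    rw [t1]
    refine (norm_add₃_le).trans ?_
    rw [norm_neg, norm_neg]
    linarith
  rw [dist_eq_norm]
  exact le_of_mul_le_mul_right hfin hp0

/-- Working version of the SDE hypothesis. -/
structure GSol {Ω : Type*} [m : MeasurableSpace Ω] (P : Measure Ω)
    (ℱ : Filtration ℝ m) (δ : ℝ → ℝ) (x : ℝ) (X : ℝ → Ω → ℝ) : Prop where
  dm : Measurable δ
  d0 : ∀ t, 0 ≤ δ t
  db : ∀ T : ℝ, ∃ C : ℝ, ∀ t ∈ Set.Icc (0 : ℝ) T, δ t ≤ C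
  x0 : 0 ≤ x
  init : ∀ ω, X 0 ω = x
  cont : ∀ ω, Continuous fun t => X t ω
  adapted : ∀ t, Measurable[ℱ t] (X t)
  mart : Martingale (fun t ω => X t ω - x - ∫ s in Set.Ioc (0 : ℝ) t, δ s) ℱ P
  qv : Martingale (fun t ω => (X t ω - x - ∫ s in Set.Ioc (0 : ℝ) t, δ s) ^ 2
      - ∫ s in Set.Ioc (0 : ℝ) t, 4 * max (X s ω) 0) ℱ P

lemma IsGBESQ.gsol {Ω : Type*} [m : MeasurableSpace Ω] {P : Measure Ω}
    {ℱ : Filtration ℝ m} {W : ℝ → Ω → ℝ} {δ : ℝ → ℝ} {x : ℝ} {X : ℝ → Ω → ℝ}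
    (h : IsGBESQ P ℱ W (fun _ => 0) δ x X) (hδ : MemD δ) (hx : 0 ≤ x) : GSol P ℱ δ x X where
  dm := hδ.1
  d0 := hδ.2.1
  db := hδ.2.2.1
  x0 := hx
  init := h.init
  cont := h.cont
  adapted := h.adapted
  mart := by simpa [gbesqDrift] using h.drift_mart
  qv := by
    have e : ∀ y : ℝ, (2 * Real.sqrt y) ^ 2 = 4 * max y 0 := by
      intro y
      rw [mul_pow]
      rcases le_total 0 y with hy | hy
      · rw [Real.sq_sqrt hy, max_eq_left hy]; norm_num
      · rw [Real.sqrt_eq_zero_of_nonpos hy, max_eq_right hy]; norm_num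
    simpa [gbesqDrift, besqSigma, e] using h.quad_var

/-- Martingale orthogonality. -/
lemma mart_smul {Ω : Type*} [m : MeasurableSpace Ω] {P : Measure Ω} [IsProbabilityMeasure P]
    {ℱ : Filtration ℝ m} {N : ℝ → Ω → ℝ} (hN : Martingale N ℱ P)
    {E : Type*} [NormedAddCommGroup E] [NormedSpace ℝ E] [CompleteSpace E]
    {s t : ℝ} (hst : s ≤ t) {Y : Ω → E} (hY : StronglyMeasurable[ℱ s] Y)
    (hi : Integrable (fun ω => N t ω • Y ω) P) :
    ∫ ω, N t ω • Y ω ∂P = ∫ ω, N s ω • Y ω ∂P := by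
  have := condExp_bilin_of_stronglyMeasurable_left (m := ℱ s) (μ := P)
    (ContinuousLinearMap.lsmul ℝ ℝ (E := E)).flip hY (g := N t) (by simpa using hi)
    (hN.integrable t)
  rw [← integral_condExp (ℱ.le s)]
  refine integral_congr_ae ?_
  filter_upwards [this, hN.2 s t hst] with ω h1 h2
  simp only [ContinuousLinearMap.flip_apply, ContinuousLinearMap.lsmul_apply] at h1
  rw [h1, h2]

namespace GSol

set_option linter.unusedSectionVars false

variable {Ω : Type*} [m : MeasurableSpace Ω] {P : Measure Ω} [IsProbabilityMeasure P]
  {ℱ : Filtration ℝ m} {δ : ℝ → ℝ} {x : ℝ} {X : ℝ → Ω → ℝ}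

lemma meas (h : GSol P ℱ δ x X) (t : ℝ) : Measurable (X t) := (h.adapted t).mono (ℱ.le t) le_rfl

lemma integrable (h : GSol P ℱ δ x X) (t : ℝ) : Integrable (X t) P := by
  have := ((h.mart.integrable t).add (integrable_const (∫ s in Set.Ioc (0 : ℝ) t, δ s))).add
    (integrable_const x)
  refine this.congr (ae_of_all _ fun ω => ?_)
  simp

lemma meas_uncurry (h : GSol P ℱ δ x X) : Measurable (fun q : Ω × ℝ => X q.2 q.1) :=
  (measurable_uncurry_of_continuous_of_measurable (u := X) h.cont h.meas).comp measurable_swap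

lemma d_int (h : GSol P ℱ δ x X) {s t : ℝ} (hs : 0 ≤ s) :
    IntegrableOn δ (Set.Ioc s t) := by
  obtain ⟨C, hC⟩ := h.db t
  refine Measure.integrableOn_of_bounded (M := C) (by simp) h.dm.aestronglyMeasurable ?_
  refine (ae_restrict_iff' measurableSet_Ioc).2 (ae_of_all _ fun r hr => ?_)
  rw [Real.norm_of_nonneg (h.d0 r)]
  exact hC r ⟨hs.trans hr.1.le, hr.2⟩

/-- increments of the drift integral -/
lemma p_sub (h : GSol P ℱ δ x X) {s t : ℝ} (hs : 0 ≤ s) (hst : s ≤ t) :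
    (∫ r in Set.Ioc (0 : ℝ) t, δ r) - ∫ r in Set.Ioc (0 : ℝ) s, δ r = ∫ r in Set.Ioc s t, δ r := by
  rw [← Set.Ioc_union_Ioc_eq_Ioc hs hst, setIntegral_union (Set.Ioc_disjoint_Ioc_of_le le_rfl)
    measurableSet_Ioc (h.d_int le_rfl) (h.d_int hs)]
  ring

lemma p_bound (h : GSol P ℱ δ x X) (T : ℝ) : ∃ C : ℝ, 0 ≤ C ∧ ∀ s t, 0 ≤ s → s ≤ t → t ≤ T →
    0 ≤ ∫ r in Set.Ioc s t, δ r ∧ ∫ r in Set.Ioc s t, δ r ≤ C * (t - s) := by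
  obtain ⟨C, hC⟩ := h.db T
  refine ⟨max C 0, le_max_right _ _, fun s t hs hst htT =>
    ⟨setIntegral_nonneg measurableSet_Ioc fun r _ => h.d0 r, ?_⟩⟩
  have : ∫ r in Set.Ioc s t, δ r ≤ ∫ r in Set.Ioc s t, max C 0 := by
    refine setIntegral_mono_on (h.d_int hs) (by simp) measurableSet_Ioc
      fun r hr => ?_
    exact (hC r ⟨hs.trans hr.1.le, hr.2.trans htT⟩).trans (le_max_left _ _)
  refine this.trans ?_
  simp [hst, mul_comm]

lemma first_moment (h : GSol P ℱ δ x X) (T : ℝ) : ∃ C : ℝ, 0 ≤ C ∧ ∀ s, 0 ≤ s → s ≤ T →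
    ∫ ω, |X s ω| ∂P ≤ C := by
  obtain ⟨C, hC0, hC⟩ := h.p_bound T
  refine ⟨∫ ω, |X T ω - x - ∫ s in Set.Ioc (0 : ℝ) T, δ s| ∂P + (x + C * |T|),
    add_nonneg (integral_nonneg fun _ => abs_nonneg _)
      (add_nonneg h.x0 (by positivity)), fun s hs hsT => ?_⟩
  have h1 : ∫ ω, |X s ω - x - ∫ r in Set.Ioc (0 : ℝ) s, δ r| ∂P
      ≤ ∫ ω, |X T ω - x - ∫ s in Set.Ioc (0 : ℝ) T, δ s| ∂P := by
    have e := integral_abs_condExp_le (m := ℱ s) (μ := P)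
      (fun ω => X T ω - x - ∫ s in Set.Ioc (0 : ℝ) T, δ s)
    refine le_trans (le_of_eq ?_) e
    refine integral_congr_ae ?_
    filter_upwards [h.mart.2 s T hsT] with ω hω
    rw [hω]
  have h2 : ∫ ω, |X s ω| ∂P ≤ ∫ ω, (|X s ω - x - ∫ r in Set.Ioc (0 : ℝ) s, δ r| + (x + C * |T|)) ∂P := by
    refine integral_mono (h.integrable s).abs
      ((h.mart.integrable s).abs.add (integrable_const _)) fun ω => ?_
    obtain ⟨q1, q2⟩ := hC 0 s le_rfl hs hsT
    have q3 : C * (s - 0) ≤ C * |T| := mul_le_mul_of_nonneg_left (by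
      rw [sub_zero]; exact hsT.trans (le_abs_self T)) hC0
    have := h.x0
    simp only
    rw [abs_le]
    constructor
    · linarith [neg_abs_le (X s ω - x - ∫ r in Set.Ioc (0 : ℝ) s, δ r)]
    · linarith [le_abs_self (X s ω - x - ∫ r in Set.Ioc (0 : ℝ) s, δ r)]
  rw [integral_add (h.mart.integrable s).abs (integrable_const _)] at h2
  simp only [integral_const, measureReal_def, measure_univ, smul_eq_mul] at h2
  simp only [ENNReal.toReal_one, one_mul] at h2
  linarith

lemma joint_int (h : GSol P ℱ δ x X) {s t : ℝ} (hs : 0 ≤ s) :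
    Integrable (fun q : Ω × ℝ => max (X q.2 q.1) 0) (P.prod (volume.restrict (Set.Ioc s t))) := by
  obtain ⟨C, hC0, hC⟩ := h.first_moment t
  have hm : Measurable (fun q : Ω × ℝ => max (X q.2 q.1) 0) := h.meas_uncurry.max measurable_const
  rw [integrable_prod_iff' hm.aestronglyMeasurable]
  refine ⟨ae_of_all _ fun r => (h.integrable r).pos_part, ?_⟩
  refine Measure.integrableOn_of_bounded (M := C) (by simp)
    (hm.norm.comp measurable_swap).stronglyMeasurable.integral_prod_right'.aestronglyMeasurable ?_
  refine (ae_restrict_iff' measurableSet_Ioc).2 (ae_of_all _ fun r hr => ?_)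
  rw [Real.norm_of_nonneg (integral_nonneg fun _ => norm_nonneg _)]
  refine le_trans ?_ (hC r (hs.trans hr.1.le) hr.2)
  refine integral_mono (h.integrable r).pos_part.norm (h.integrable r).abs fun ω => ?_
  simp only [Real.norm_eq_abs]
  rw [abs_of_nonneg (le_max_right _ _)]
  exact max_le (le_abs_self _) (abs_nonneg _)

lemma I_int (h : GSol P ℱ δ x X) {s t : ℝ} (hs : 0 ≤ s) :
    Integrable (fun ω => ∫ r in Set.Ioc s t, 4 * max (X r ω) 0) P :=
  ((h.joint_int hs).const_mul 4).integral_prod_left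

lemma I_sub (h : GSol P ℱ δ x X) {s t : ℝ} (hs : 0 ≤ s) (hst : s ≤ t) (ω : Ω) :
    (∫ r in Set.Ioc (0 : ℝ) t, 4 * max (X r ω) 0) - ∫ r in Set.Ioc (0 : ℝ) s, 4 * max (X r ω) 0
      = ∫ r in Set.Ioc s t, 4 * max (X r ω) 0 := by
  have hc : Continuous (fun r => 4 * max (X r ω) 0) := by
    have := h.cont ω
    fun_prop
  have hi : ∀ a b : ℝ, IntegrableOn (fun r => 4 * max (X r ω) 0) (Set.Ioc a b) := fun a b =>
    (hc.integrableOn_Icc (a := a) (b := b)).mono_set Set.Ioc_subset_Icc_self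
  rw [← Set.Ioc_union_Ioc_eq_Ioc hs hst, setIntegral_union (Set.Ioc_disjoint_Ioc_of_le le_rfl)
    measurableSet_Ioc (hi _ _) (hi _ _)]
  ring

lemma M_sq_int (h : GSol P ℱ δ x X) (t : ℝ) :
    Integrable (fun ω => (X t ω - x - ∫ s in Set.Ioc (0 : ℝ) t, δ s) ^ 2) P := by
  refine ((h.qv.integrable t).add (h.I_int (t := t) le_rfl)).congr (ae_of_all _ fun ω => ?_)
  simp

lemma M_meas (h : GSol P ℱ δ x X) (t : ℝ) :
    StronglyMeasurable[ℱ t] (fun ω => X t ω - x - ∫ s in Set.Ioc (0 : ℝ) t, δ s) := h.mart.1 t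

lemma M_memLp (h : GSol P ℱ δ x X) (t : ℝ) :
    MemLp (fun ω => X t ω - x - ∫ s in Set.Ioc (0 : ℝ) t, δ s) 2 P :=
  (memLp_two_iff_integrable_sq ((h.M_meas t).mono (ℱ.le t)).aestronglyMeasurable).2 (h.M_sq_int t)

lemma memLp (h : GSol P ℱ δ x X) (t : ℝ) : MemLp (X t) 2 P := by
  have := (h.M_memLp t).add (memLp_const (x + ∫ s in Set.Ioc (0 : ℝ) t, δ s))
  refine this.ae_eq (ae_of_all _ fun ω => ?_)
  simp

lemma dM_sq (h : GSol P ℱ δ x X) {E : Type*} [NormedAddCommGroup E] [NormedSpace ℝ E]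
    [CompleteSpace E] {s t : ℝ} (hs : 0 ≤ s) (hst : s ≤ t) {Y : Ω → E}
    (hY : StronglyMeasurable[ℱ s] Y) {K : ℝ} (hK : ∀ ω, ‖Y ω‖ ≤ K) :
    ∫ ω, ((X t ω - x - ∫ r in Set.Ioc (0 : ℝ) t, δ r)
        - (X s ω - x - ∫ r in Set.Ioc (0 : ℝ) s, δ r)) ^ 2 • Y ω ∂P
      = ∫ ω, (∫ r in Set.Ioc s t, 4 * max (X r ω) 0) • Y ω ∂P := by
  set M : ℝ → Ω → ℝ := fun t ω => X t ω - x - ∫ r in Set.Ioc (0 : ℝ) t, δ r with hM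
  set J : ℝ → Ω → ℝ := fun t ω => M t ω ^ 2 - ∫ s in Set.Ioc (0 : ℝ) t, 4 * max (X s ω) 0 with hJ
  have hY' : AEStronglyMeasurable Y P := (hY.mono (ℱ.le s)).aestronglyMeasurable
  have bi : ∀ f : Ω → ℝ, Integrable f P → Integrable (fun ω => f ω • Y ω) P := fun f hf =>
    hf.smul_bdd K hY' (ae_of_all _ hK)
  have i1 := bi _ (h.qv.integrable t)
  have i2 := bi _ (h.qv.integrable s)
  have i3 : Integrable (fun ω => M t ω • (M s ω • Y ω)) P := by
    have := bi _ ((h.M_memLp t).integrable_mul (h.M_memLp s))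
    refine this.congr (ae_of_all _ fun ω => ?_)
    simp [mul_smul, hM]
  have i4 : Integrable (fun ω => M s ω • (M s ω • Y ω)) P := by
    have := bi _ ((h.M_memLp s).integrable_mul (h.M_memLp s))
    refine this.congr (ae_of_all _ fun ω => ?_)
    simp [mul_smul, hM]
  have e1 := mart_smul h.qv hst hY i1
  have e2 := mart_smul h.mart hst ((h.M_meas s).smul hY) i3
  have i5 : Integrable (fun ω => (M t ω - M s ω) ^ 2 • Y ω) P :=
    bi _ ((h.M_memLp t).sub (h.M_memLp s)).integrable_sq
  have i6 := bi _ (h.I_int (t := t) hs)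
  rw [← sub_eq_zero, ← integral_sub i5 i6]
  have e3 : ∫ ω, ((J t ω • Y ω - J s ω • Y ω) - (2:ℝ) • (M t ω • (M s ω • Y ω) - M s ω • (M s ω • Y ω))) ∂P
      = 0 := by
    have j1 : Integrable (fun ω => J t ω • Y ω - J s ω • Y ω) P := i1.sub i2
    have j2 : Integrable (fun ω => (2:ℝ) • (M t ω • (M s ω • Y ω) - M s ω • (M s ω • Y ω))) P :=
      (i3.sub i4).smul (2:ℝ)
    have k1 : ∫ ω, (J t ω • Y ω - J s ω • Y ω) ∂P = 0 := by
      rw [integral_sub i1 i2, sub_eq_zero]; exact e1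
    have k2 : ∫ ω, (M t ω • (M s ω • Y ω) - M s ω • (M s ω • Y ω)) ∂P = 0 := by
      rw [integral_sub i3 i4, sub_eq_zero]; exact e2
    rw [integral_sub j1 j2, integral_smul, k1, k2, smul_zero, sub_zero]
  rw [← e3]
  refine integral_congr_ae (ae_of_all _ fun ω => ?_)
  simp only [hJ]
  rw [← h.I_sub hs hst ω]
  simp only [smul_sub, smul_smul, ← sub_smul]
  congr 1
  ring

/-- first-order one-step identity -/
lemma step_one (h : GSol P ℱ δ x X) {E : Type*} [NormedAddCommGroup E] [NormedSpace ℝ E]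
    [CompleteSpace E] {s t : ℝ} (hs : 0 ≤ s) (hst : s ≤ t) {Y : Ω → E}
    (hY : StronglyMeasurable[ℱ s] Y) {K : ℝ} (hK : ∀ ω, ‖Y ω‖ ≤ K) :
    ∫ ω, (X t ω - X s ω) • Y ω ∂P = (∫ r in Set.Ioc s t, δ r) • ∫ ω, Y ω ∂P := by
  have hY' : AEStronglyMeasurable Y P := (hY.mono (ℱ.le s)).aestronglyMeasurable
  have bi : ∀ f : Ω → ℝ, Integrable f P → Integrable (fun ω => f ω • Y ω) P := fun f hf =>
    hf.smul_bdd K hY' (ae_of_all _ hK)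
  have hYi : Integrable Y P := Integrable.of_bound hY' K (ae_of_all _ hK)
  have i1 := bi _ (h.mart.integrable t)
  have i2 := bi _ (h.mart.integrable s)
  have e1 := mart_smul h.mart hst hY i1
  rw [← sub_eq_zero, ← integral_sub i1 i2] at e1
  have j1 : Integrable (fun ω => (X t ω - X s ω) • Y ω) P :=
    bi _ ((h.integrable t).sub (h.integrable s))
  have j2 : Integrable (fun ω => (∫ r in Set.Ioc s t, δ r) • Y ω) P := hYi.smul _
  rw [← integral_smul, ← sub_eq_zero, ← integral_sub j1 j2, ← e1]
  refine integral_congr_ae (ae_of_all _ fun ω => ?_)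
  simp only
  rw [← h.p_sub hs hst]
  simp only [← sub_smul, Pi.sub_apply]
  congr 1
  ring
end GSol

namespace GSol

set_option linter.unusedSectionVars false

variable {Ω : Type*} [m : MeasurableSpace Ω] {P : Measure Ω} [IsProbabilityMeasure P]
  {ℱ : Filtration ℝ m} {δ : ℝ → ℝ} {x : ℝ} {X : ℝ → Ω → ℝ}

lemma I_swap (h : GSol P ℱ δ x X) {E : Type*} [NormedAddCommGroup E] [NormedSpace ℝ E]
    [CompleteSpace E] {s t : ℝ} (hs : 0 ≤ s) {Y : Ω → E}
    (hY : StronglyMeasurable Y) {K : ℝ} (hK : ∀ ω, ‖Y ω‖ ≤ K) :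
    ∫ ω, (∫ r in Set.Ioc s t, 4 * max (X r ω) 0) • Y ω ∂P
      = ∫ r in Set.Ioc s t, (∫ ω, (4 * max (X r ω) 0) • Y ω ∂P) := by
  have hi : Integrable (fun q : Ω × ℝ => (4 * max (X q.2 q.1) 0) • Y q.1)
      (P.prod (volume.restrict (Set.Ioc s t))) := by
    have hm : StronglyMeasurable (fun q : Ω × ℝ => Y q.1) := hY.comp_measurable measurable_fst
    exact ((h.joint_int hs).const_mul 4).smul_bdd K hm.aestronglyMeasurable
      (ae_of_all _ fun q => hK q.1)
  rw [← integral_integral_swap hi]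
  refine integral_congr_ae (ae_of_all _ fun ω => ?_)
  simp only
  rw [integral_smul_const]

lemma dX_sq (h : GSol P ℱ δ x X) (T : ℝ) : ∃ C : ℝ, 0 ≤ C ∧ ∀ s t, 0 ≤ s → s ≤ t → t ≤ T →
    ∫ ω, (X t ω - X s ω) ^ 2 ∂P ≤ C * (t - s) := by
  obtain ⟨C, hC0, hC⟩ := h.p_bound T
  obtain ⟨D, hD0, hD⟩ := h.first_moment T
  refine ⟨2 * (4 * D) + 2 * (C * (C * |T|)), by positivity, fun s t hs hst htT => ?_⟩
  have e := h.dM_sq (E := ℝ) (Y := fun _ => 1) hs hst stronglyMeasurable_const (K := 1) (by simp)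
  rw [h.I_swap hs stronglyMeasurable_const (K := 1) (by simp)] at e
  simp only [smul_eq_mul, mul_one] at e
  have b : ∫ r in Set.Ioc s t, (∫ ω, (4 * max (X r ω) 0) ∂P) ≤ 4 * D * (t - s) := by
    have hb : ∀ r ∈ Set.Ioc s t, ‖∫ ω, (4 * max (X r ω) 0) ∂P‖ ≤ 4 * D := by
      intro r hr
      rw [integral_const_mul, norm_mul, Real.norm_of_nonneg (by norm_num : (0:ℝ) ≤ 4),
        Real.norm_of_nonneg (integral_nonneg (f := fun ω => max (X r ω) 0)
          fun _ => le_max_right _ _)]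
      refine mul_le_mul_of_nonneg_left ?_ (by norm_num)
      refine le_trans ?_ (hD r (hs.trans hr.1.le) (hr.2.trans htT))
      exact integral_mono (h.integrable r).pos_part (h.integrable r).abs
        fun ω => max_le (le_abs_self _) (abs_nonneg _)
    have := norm_setIntegral_le_of_norm_le_const (μ := volume) (by simp) hb
    refine (le_abs_self _).trans (this.trans (le_of_eq ?_))
    simp [measureReal_def, hst]
  rw [← e] at b
  set M : ℝ → Ω → ℝ := fun t ω => X t ω - x - ∫ r in Set.Ioc (0 : ℝ) t, δ r with hM
  have i5 : Integrable (fun ω => (M t ω - M s ω) ^ 2) P :=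
    ((h.M_memLp t).sub (h.M_memLp s)).integrable_sq
  obtain ⟨q1, q2⟩ := hC s t hs hst htT
  have q3 : (∫ r in Set.Ioc s t, δ r) ^ 2 ≤ C * (C * |T|) * (t - s) := by
    have : t - s ≤ |T| := by linarith [le_abs_self T]
    have h1 : 0 ≤ t - s := by linarith
    calc (∫ r in Set.Ioc s t, δ r) ^ 2 ≤ (C * (t - s)) ^ 2 := pow_le_pow_left₀ q1 q2 2
      _ = C * (C * (t - s)) * (t - s) := by ring
      _ ≤ C * (C * |T|) * (t - s) := by gcongr
  have : ∫ ω, (X t ω - X s ω) ^ 2 ∂P ≤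
      ∫ ω, (2 * (M t ω - M s ω) ^ 2 + 2 * (C * (C * |T|) * (t - s))) ∂P := by
    refine integral_mono ((h.memLp t).sub (h.memLp s)).integrable_sq
      ((i5.const_mul 2).add (integrable_const _)) fun ω => ?_
    have e2 : X t ω - X s ω = (M t ω - M s ω) + ∫ r in Set.Ioc s t, δ r := by
      rw [← h.p_sub hs hst]; simp only [hM]; ring
    simp only
    rw [e2]
    nlinarith [sq_nonneg ((M t ω - M s ω) - ∫ r in Set.Ioc s t, δ r)]
  rw [integral_add (i5.const_mul 2) (integrable_const _), integral_const_mul] at this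
  simp only [integral_const, measureReal_def, measure_univ, smul_eq_mul,
    ENNReal.toReal_one, one_mul] at this
  have b' : ∫ ω, (M t ω - M s ω) ^ 2 ∂P ≤ 4 * D * (t - s) := b
  linarith

lemma dX_abs (h : GSol P ℱ δ x X) (T : ℝ) : ∃ C : ℝ, 0 ≤ C ∧ ∀ s t, 0 ≤ s → s ≤ t → t ≤ T →
    ∫ ω, |X t ω - X s ω| ∂P ≤ C * √(t - s) := by
  obtain ⟨C, hC0, hC⟩ := h.dX_sq T
  refine ⟨(1 + C) / 2, by positivity, fun s t hs hst htT => ?_⟩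
  rcases hst.eq_or_lt with rfl | hlt
  · simp
  have hp : 0 < √(t - s) := Real.sqrt_pos.2 (by linarith)
  have hq : √(t - s) * √(t - s) = t - s := Real.mul_self_sqrt (by linarith)
  have i2 : Integrable (fun ω => (X t ω - X s ω) ^ 2) P :=
    ((h.memLp t).sub (h.memLp s)).integrable_sq
  have : ∫ ω, |X t ω - X s ω| ∂P ≤
      ∫ ω, (√(t - s) / 2 + (1 / (2 * √(t - s))) * (X t ω - X s ω) ^ 2) ∂P := by
    refine integral_mono ((h.integrable t).sub (h.integrable s)).abs
      ((integrable_const _).add (i2.const_mul _)) fun ω => ?_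
    simp only
    rw [← sub_nonneg]
    have : √(t - s) / 2 + (1 / (2 * √(t - s))) * (X t ω - X s ω) ^ 2 - |X t ω - X s ω|
        = (√(t - s) - |X t ω - X s ω|) ^ 2 / (2 * √(t - s)) := by
      rw [← sq_abs (X t ω - X s ω)]
      field_simp
      ring
    rw [this]
    positivity
  rw [integral_add (integrable_const _) (i2.const_mul _), integral_const_mul] at this
  simp only [integral_const, measureReal_def, measure_univ, smul_eq_mul,
    ENNReal.toReal_one, one_mul] at this
  have h3 := mul_le_mul_of_nonneg_left (hC s t hs hst htT)
    (by positivity : 0 ≤ 1 / (2 * √(t - s)))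
  have h4 : 1 / (2 * √(t - s)) * (C * (t - s)) = C / 2 * √(t - s) := by
    rw [show C * (t - s) = C * (√(t - s) * √(t - s)) by rw [hq]]
    field_simp
  linarith

/-- second-order one-step estimate -/
lemma step_two (h : GSol P ℱ δ x X) (E : Type*) [NormedAddCommGroup E] [NormedSpace ℝ E]
    [CompleteSpace E] (T : ℝ) {K : ℝ} (hK0 : 0 ≤ K) :
    ∃ C : ℝ, 0 ≤ C ∧ ∀ s t, 0 ≤ s → s ≤ t → t ≤ T →
    ∀ Y : Ω → E, StronglyMeasurable[ℱ s] Y → (∀ ω, ‖Y ω‖ ≤ K) →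
    ‖∫ ω, (X t ω - X s ω) ^ 2 • Y ω ∂P - (4 * (t - s)) • ∫ ω, max (X s ω) 0 • Y ω ∂P‖
      ≤ C * ((t - s) * √(t - s)) := by
  obtain ⟨C, hC0, hC⟩ := h.p_bound T
  obtain ⟨D, hD0, hD⟩ := h.dX_abs T
  refine ⟨C * C * √|T| * K + 4 * K * D, by positivity, fun s t hs hst htT Y hY hK => ?_⟩
  have hY' : AEStronglyMeasurable Y P := (hY.mono (ℱ.le s)).aestronglyMeasurable
  have bi : ∀ f : Ω → ℝ, Integrable f P → Integrable (fun ω => f ω • Y ω) P := fun f hf =>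
    hf.smul_bdd K hY' (ae_of_all _ hK)
  have hYi : Integrable Y P := Integrable.of_bound hY' K (ae_of_all _ hK)
  have e := h.dM_sq hs hst hY hK
  rw [h.I_swap hs (hY.mono (ℱ.le s)) hK] at e
  set p := ∫ r in Set.Ioc s t, δ r with hp
  have e1 := h.step_one hs hst hY hK
  set M : ℝ → Ω → ℝ := fun t ω => X t ω - x - ∫ r in Set.Ioc (0 : ℝ) t, δ r with hM
  have e' : ∫ ω, (M t ω - M s ω) ^ 2 • Y ω ∂P
    = ∫ r in Set.Ioc s t, (∫ ω, (4 * max (X r ω) 0) • Y ω ∂P) := e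
  have i1 : Integrable (fun ω => (M t ω - M s ω) ^ 2 • Y ω) P :=
    bi _ ((h.M_memLp t).sub (h.M_memLp s)).integrable_sq
  have i2 : Integrable (fun ω => (X t ω - X s ω) • Y ω) P :=
    bi _ ((h.integrable t).sub (h.integrable s))
  have k1 : ∫ ω, (X t ω - X s ω) ^ 2 • Y ω ∂P
      = ∫ ω, (M t ω - M s ω) ^ 2 • Y ω ∂P + (p ^ 2) • ∫ ω, Y ω ∂P := by
    have : ∀ ω, (X t ω - X s ω) ^ 2 • Y ω
        = ((M t ω - M s ω) ^ 2 • Y ω + (2 * p) • ((X t ω - X s ω) • Y ω)) - (p ^ 2) • Y ω := by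
      intro ω
      have e2 : M t ω - M s ω = (X t ω - X s ω) - p := by
        rw [hp, ← h.p_sub hs hst]; simp only [hM]; ring
      rw [e2, smul_smul, ← add_smul, ← sub_smul]
      congr 1
      ring
    simp_rw [this]
    have i12 : Integrable (fun ω => (M t ω - M s ω) ^ 2 • Y ω + (2 * p) • ((X t ω - X s ω) • Y ω)) P :=
      i1.add (i2.smul (2 * p))
    have i3 : Integrable (fun ω => (p ^ 2) • Y ω) P := hYi.smul (p ^ 2)
    have i4 : Integrable (fun ω => (2 * p) • ((X t ω - X s ω) • Y ω)) P := i2.smul (2 * p)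
    rw [integral_sub i12 i3, integral_add i1 i4, integral_smul, integral_smul, e1, smul_smul,
      add_sub_assoc, ← sub_smul]
    congr 2
    ring
  have k2 : (4 * (t - s)) • ∫ ω, max (X s ω) 0 • Y ω ∂P
      = ∫ r in Set.Ioc s t, (∫ ω, (4 * max (X s ω) 0) • Y ω ∂P) := by
    have : ∀ ω, (4 * max (X s ω) 0) • Y ω = (4:ℝ) • (max (X s ω) 0 • Y ω) := fun ω => mul_smul _ _ _
    simp_rw [this]
    rw [integral_smul, setIntegral_const, measureReal_def, Real.volume_Ioc,
      ENNReal.toReal_ofReal (by linarith), smul_smul, mul_comm]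
  have hpos : ∀ r, Integrable (fun ω => (4 * max (X r ω) 0) • Y ω) P := fun r =>
    bi _ ((h.integrable r).pos_part.const_mul 4)
  have iR : IntegrableOn (fun r => ∫ ω, (4 * max (X r ω) 0) • Y ω ∂P) (Set.Ioc s t) := by
    have hi : Integrable (fun q : Ω × ℝ => (4 * max (X q.2 q.1) 0) • Y q.1)
        (P.prod (volume.restrict (Set.Ioc s t))) := by
      have hm : StronglyMeasurable (fun q : Ω × ℝ => Y q.1) :=
        (hY.mono (ℱ.le s)).comp_measurable measurable_fst
      exact ((h.joint_int hs).const_mul 4).smul_bdd K hm.aestronglyMeasurable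
        (ae_of_all _ fun q => hK q.1)
    exact hi.integral_prod_right
  rw [k1, e', k2, add_sub_right_comm, ← integral_sub iR (by simp)]
  have hst0 : 0 ≤ t - s := by linarith
  have b1 : ‖(p ^ 2) • ∫ ω, Y ω ∂P‖ ≤ C * C * √|T| * K * ((t - s) * √(t - s)) := by
    obtain ⟨q1, q2⟩ := hC s t hs hst htT
    have hn : ‖∫ ω, Y ω ∂P‖ ≤ K := by
      simpa using norm_integral_le_of_norm_le_const (μ := P) (ae_of_all _ hK)
    rw [norm_smul, Real.norm_of_nonneg (sq_nonneg _)]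
    have hq : t - s = √(t - s) * √(t - s) := (Real.mul_self_sqrt (by linarith)).symm
    have hle : √(t - s) ≤ √|T| := Real.sqrt_le_sqrt (by linarith [le_abs_self T])
    calc p ^ 2 * ‖∫ ω, Y ω ∂P‖ ≤ (C * (t - s)) ^ 2 * K := by gcongr
      _ = C * C * √(t - s) * K * ((t - s) * √(t - s)) := by
        rw [show (C * (t - s)) ^ 2 * K = C * C * K * (t - s) * (t - s) by ring]
        nth_rewrite 2 [hq]
        ring
      _ ≤ _ := by gcongr
  have b2 : ‖∫ r in Set.Ioc s t, ((∫ ω, (4 * max (X r ω) 0) • Y ω ∂P)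
      - ∫ ω, (4 * max (X s ω) 0) • Y ω ∂P)‖ ≤ 4 * K * D * √(t - s) * (t - s) := by
    have hb : ∀ r ∈ Set.Ioc s t, ‖(∫ ω, (4 * max (X r ω) 0) • Y ω ∂P)
      - ∫ ω, (4 * max (X s ω) 0) • Y ω ∂P‖ ≤ 4 * K * D * √(t - s) := by
      intro r hr
      rw [← integral_sub (hpos r) (hpos s)]
      have ii : Integrable (fun ω => 4 * K * |X r ω - X s ω|) P :=
        ((h.integrable r).sub (h.integrable s)).abs.const_mul _
      refine (norm_integral_le_of_norm_le ii (ae_of_all _ fun ω => ?_)).trans ?_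
      · rw [← sub_smul, norm_smul, ← mul_sub, norm_mul, Real.norm_of_nonneg (by norm_num : (0:ℝ) ≤ 4)]
        have := abs_max_sub_max_le_abs (X r ω) (X s ω) 0
        calc 4 * ‖max (X r ω) 0 - max (X s ω) 0‖ * ‖Y ω‖ ≤ 4 * |X r ω - X s ω| * K := by
              gcongr
              · exact this
              · exact hK ω
          _ = _ := by ring
      · rw [integral_const_mul]
        have h1 := hD s r hs hr.1.le (hr.2.trans htT)
        have h2 : √(r - s) ≤ √(t - s) := Real.sqrt_le_sqrt (by linarith [hr.2])
        calc 4 * K * ∫ ω, |X r ω - X s ω| ∂P ≤ 4 * K * (D * √(t - s)) := by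
              gcongr
              exact h1.trans (by gcongr)
          _ = _ := by ring
    have := norm_setIntegral_le_of_norm_le_const (μ := volume) (by simp) hb
    refine this.trans (le_of_eq ?_)
    simp [measureReal_def, hst]
  refine (norm_add_le _ _).trans ?_
  linarith
end GSol

open Classical in
lemma telescope_exit (N : ℕ → ℝ) (a : ℕ → Prop) (ha : ∀ k, a (k + 1) → a k) (n : ℕ) :
    ∃ i, i ≤ n ∧ (a n → i = n) ∧
      ∑ k ∈ Finset.range n, (if a k then N (k + 1) - N k else 0) = N i - N 0 := by
  induction n with
  | zero => exact ⟨0, le_rfl, fun _ => rfl, by simp⟩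
  | succ n ih =>
    obtain ⟨i, hi, hi', he⟩ := ih
    rw [Finset.sum_range_succ, he]
    by_cases h : a n
    · refine ⟨n + 1, le_rfl, fun _ => rfl, ?_⟩
      rw [if_pos h, hi' h]; ring
    · refine ⟨i, hi.trans (Nat.le_succ n), fun h' => absurd (ha n h') h, ?_⟩
      rw [if_neg h]; ring

open Classical in
lemma first_exit_sum (a b : ℕ → Prop) (ha : ∀ k, a (k + 1) → a k ∧ b k) (n : ℕ) :
    ∑ k ∈ Finset.range n, (if a k ∧ ¬ b k then (1:ℝ) else 0)
      ≤ if (∃ k < n, ¬ b k) then 1 else 0 := by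
  have key : ∑ k ∈ Finset.range n, (if a k ∧ ¬ b k then (1:ℝ) else 0) + (if a n then 1 else 0) ≤ 1 := by
    induction n with
    | zero => simp only [Finset.range_zero, Finset.sum_empty, zero_add]; split_ifs <;> norm_num
    | succ n ih =>
      rw [Finset.sum_range_succ]
      have : (if a n ∧ ¬ b n then (1:ℝ) else 0) + (if a (n + 1) then 1 else 0) ≤ if a n then 1 else 0 := by
        by_cases h : a n <;> by_cases h' : b n <;> by_cases h'' : a (n + 1) <;>
          simp [h, h', h'']
        · exact (h' (ha n h'').2).elim
        · exact (h (ha n h'').1).elim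
        · exact (h (ha n h'').1).elim
      linarith
  split_ifs with hE
  · have : (0:ℝ) ≤ if a n then 1 else 0 := by split_ifs <;> norm_num
    linarith
  · push Not at hE
    refine le_of_eq (Finset.sum_eq_zero fun k hk => ?_)
    rw [if_neg]
    rintro ⟨_, h2⟩
    exact h2 (hE k (Finset.mem_range.1 hk))

/-- uniform continuity on grids -/
lemma grid_small {f : ℝ → ℝ} (hf : Continuous f) {s T : ℝ} (hsT : s ≤ T) {ε : ℝ} (hε : 0 < ε) :
    ∀ᶠ n : ℕ in atTop, ∀ k < n + 1,
      |f (s + ((k + 1 : ℕ) : ℝ) * ((T - s) / (n + 1))) - f (s + (k : ℝ) * ((T - s) / (n + 1)))| ≤ ε := by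
  have hu := (isCompact_Icc (a := s) (b := T)).uniformContinuousOn_of_continuous hf.continuousOn
  rw [Metric.uniformContinuousOn_iff_le] at hu
  obtain ⟨η, hη, hu⟩ := hu ε hε
  have ht : Tendsto (fun n : ℕ => (T - s) / ((n : ℝ) + 1)) atTop (nhds 0) := by
    have := tendsto_one_div_add_atTop_nhds_zero_nat (𝕜 := ℝ)
    simpa [div_eq_mul_inv] using this.const_mul (T - s)
  filter_upwards [ht.eventually (gt_mem_nhds hη)] with n hn k hk
  have hh0 : 0 ≤ (T - s) / ((n : ℝ) + 1) := div_nonneg (by linarith) (by positivity)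
  have hk' : ∀ j : ℕ, j ≤ n + 1 → s + (j : ℝ) * ((T - s) / (n + 1)) ∈ Set.Icc s T := by
    intro j hj
    refine ⟨by nlinarith [mul_nonneg (Nat.cast_nonneg (α := ℝ) j) hh0], ?_⟩
    have : (j : ℝ) * ((T - s) / (n + 1)) ≤ ((n : ℝ) + 1) * ((T - s) / (n + 1)) := by
      refine mul_le_mul_of_nonneg_right ?_ hh0
      exact_mod_cast hj
    rw [mul_div_cancel₀ _ (by positivity)] at this
    linarith
  have := hu _ (hk' (k + 1) hk) _ (hk' k hk.le) (by
    rw [Real.dist_eq]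
    push_cast
    rw [show s + ((k : ℝ) + 1) * ((T - s) / (n + 1)) - (s + k * ((T - s) / (n + 1)))
      = (T - s) / (n + 1) by ring, abs_of_nonneg hh0]
    exact hn.le)
  rwa [Real.dist_eq] at this

lemma measSet_abs_le {Ω : Type*} (mm : MeasurableSpace Ω) {f : Ω → ℝ} (hf : Measurable f) (ε : ℝ) :
    MeasurableSet {ω | |f ω| ≤ ε} := measurableSet_le hf.abs measurable_const

namespace GSol

set_option linter.unusedSectionVars false

variable {Ω : Type*} [m : MeasurableSpace Ω] {P : Measure Ω} [IsProbabilityMeasure P]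
  {ℱ : Filtration ℝ m} {δ : ℝ → ℝ} {x : ℝ} {X : ℝ → Ω → ℝ}

lemma M_sq_le (h : GSol P ℱ δ x X) {s t : ℝ} (hst : s ≤ t) {G : Set Ω}
    (hG : MeasurableSet[ℱ s] G) :
    ∫ ω in G, (X s ω - x - ∫ r in Set.Ioc (0 : ℝ) s, δ r) ^ 2 ∂P
      ≤ ∫ ω in G, (X t ω - x - ∫ r in Set.Ioc (0 : ℝ) t, δ r) ^ 2 ∂P := by
  set M : ℝ → Ω → ℝ := fun t ω => X t ω - x - ∫ r in Set.Ioc (0 : ℝ) t, δ r with hM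
  have hG' := ℱ.le s _ hG
  have i2 : Integrable (fun ω => M t ω * M s ω) P := (h.M_memLp t).integrable_mul (h.M_memLp s)
  have i1 : Integrable (fun ω => M s ω * M s ω) P := (h.M_memLp s).integrable_mul (h.M_memLp s)
  have ind : ∀ f : Ω → ℝ, (fun ω => f ω • G.indicator (M s) ω) = G.indicator (fun ω => f ω * M s ω) := by
    intro f; ext ω; by_cases hω : ω ∈ G <;> simp [hω]
  have e := mart_smul h.mart hst (Y := G.indicator (M s)) ((h.M_meas s).indicator hG) (by
    rw [ind]; exact i2.indicator hG')
  rw [ind, ind, integral_indicator hG', integral_indicator hG'] at e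
  have key : 0 ≤ ∫ ω in G, (M t ω - M s ω) ^ 2 ∂P := integral_nonneg fun _ => sq_nonneg _
  have e2 : ∫ ω in G, (M t ω - M s ω) ^ 2 ∂P = ∫ ω in G, ((M t ω ^ 2 - M s ω ^ 2) -
      2 * (M t ω * M s ω - M s ω * M s ω)) ∂P := by
    congr 1; ext ω; ring
  have j1 : IntegrableOn (fun ω => M t ω ^ 2) G P := (h.M_sq_int t).integrableOn
  have j2 : IntegrableOn (fun ω => M s ω ^ 2) G P := (h.M_sq_int s).integrableOn
  have j3 : IntegrableOn (fun ω => M t ω ^ 2 - M s ω ^ 2) G P := j1.sub j2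
  have j4 : IntegrableOn (fun ω => M t ω * M s ω - M s ω * M s ω) G P :=
    i2.integrableOn.sub i1.integrableOn
  have e' : ∫ ω in G, M t ω * M s ω ∂P = ∫ ω in G, M s ω * M s ω ∂P := e
  rw [e2, integral_sub j3 (j4.const_mul 2), integral_const_mul, integral_sub j1 j2,
    integral_sub i2.integrableOn i1.integrableOn, e'] at key
  change ∫ ω in G, M s ω ^ 2 ∂P ≤ ∫ ω in G, M t ω ^ 2 ∂P
  linarith

open Classical in
lemma key_mono (h : GSol P ℱ δ x X) {s T : ℝ} (hs : 0 ≤ s) (hsT : s ≤ T) {N : ℝ → Ω → ℝ}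
    {B C : ℝ} (hC : 0 ≤ C) (hN : ∀ t, Measurable (N t)) (hB : ∀ t ω, |N t ω| ≤ B)
    (hstep : ∀ a b, s ≤ a → a ≤ b → b ≤ T → ∀ A, MeasurableSet[ℱ a] A →
      ∫ ω in A, (N b ω - N a ω) ∂P ≤
        C * (∫ ω in A, (X b ω - X a ω) ^ 2 * min |X b ω - X a ω| 1 ∂P + (b - a) * √(b - a))) :
    ∫ ω, N T ω ∂P ≤ ∫ ω, N s ω ∂P := by
  obtain ⟨D, hD0, hD⟩ := h.dX_sq T
  obtain ⟨c, hc0, hc⟩ : ∃ c : ℝ, 0 ≤ c ∧ ∀ t, 0 ≤ t → t ≤ T → 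
      0 ≤ x + ∫ r in Set.Ioc (0 : ℝ) t, δ r ∧ x + ∫ r in Set.Ioc (0 : ℝ) t, δ r ≤ c := by
    obtain ⟨c, hc0, hc⟩ := h.p_bound T
    refine ⟨x + c * T, by have := h.x0; have := hs.trans hsT; positivity, fun t h0 ht => ?_⟩
    obtain ⟨q1, q2⟩ := hc 0 t le_rfl h0 ht
    refine ⟨by linarith [h.x0], ?_⟩
    have : c * (t - 0) ≤ c * T := by gcongr; linarith
    linarith
  have hBp : 0 ≤ B := by
    have : Nonempty Ω := by
      by_contra hne
      rw [not_nonempty_iff] at hne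
      have := measure_univ (μ := P)
      simp [Set.univ_eq_empty_iff.2 hne] at this
    exact (abs_nonneg _).trans (hB 0 (Classical.arbitrary Ω))
  set τ : ℕ → ℕ → ℝ := fun n k => s + (k : ℝ) * ((T - s) / (n + 1)) with hτ
  have τ0 : ∀ n, τ n 0 = s := by intro n; simp [hτ]
  have τn : ∀ n, τ n (n + 1) = T := by
    intro n; simp only [hτ]; push_cast
    rw [mul_div_cancel₀ _ (by positivity)]; ring
  have hh : ∀ n : ℕ, 0 ≤ (T - s) / ((n : ℝ) + 1) := fun n => div_nonneg (by linarith) (by positivity)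
  have τd : ∀ n k, τ n (k + 1) - τ n k = (T - s) / ((n : ℝ) + 1) := by
    intro n k; simp only [hτ]; push_cast; ring
  have τm : ∀ n, Monotone (τ n) := fun n => monotone_nat_of_le_succ fun k => by
    have := τd n k; have := hh n; linarith
  have τs : ∀ n k, s ≤ τ n k := fun n k => by rw [← τ0 n]; exact τm n (Nat.zero_le k)
  have τT : ∀ n k, k ≤ n + 1 → τ n k ≤ T := fun n k hk => by rw [← τn n]; exact τm n hk
  -- bad events
  let J : ℝ → ℕ → Set Ω := fun ε n => {ω | ∃ k < n + 1, ¬ |X (τ n (k + 1)) ω - X (τ n k) ω| ≤ ε}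
  let F : ℝ → ℕ → Set Ω := fun R n => {ω | ∃ k ≤ n + 1, ¬ |X (τ n k) ω| ≤ R}
  have hJm : ∀ ε n, MeasurableSet (J ε n) := by
    intro ε n
    have : J ε n = ⋃ k ∈ Finset.range (n + 1), {ω | |X (τ n (k + 1)) ω - X (τ n k) ω| ≤ ε}ᶜ := by
      ext ω; simp [J]
    rw [this]
    exact Finset.measurableSet_biUnion _ fun k _ =>
      (measurableSet_le ((h.meas _).sub (h.meas _)).abs measurable_const).compl
  have hFm : ∀ ε n, MeasurableSet (F ε n) := by
    intro ε n
    have : F ε n = ⋃ k ∈ Finset.range (n + 2), {ω | |X (τ n k) ω| ≤ ε}ᶜ := by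
      ext ω; simp [F, Nat.lt_succ_iff]
    rw [this]
    exact Finset.measurableSet_biUnion _ fun k _ =>
      (measurableSet_le (h.meas _).abs measurable_const).compl
  set M : ℝ → Ω → ℝ := fun t ω => X t ω - x - ∫ r in Set.Ioc (0 : ℝ) t, δ r with hM
  have hMT := h.M_sq_int T
  -- main estimate
  have main : ∀ ε > 0, ∀ R > 0, ∀ n, ∫ ω, N T ω ∂P - ∫ ω, N s ω ∂P ≤
      C * (ε * (D * (T - s)) + ∫ ω in J ε n, (4 * M T ω ^ 2 + (4 * c ^ 2 + 2 * R ^ 2)) ∂P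
        + (T - s) * √((T - s) / ((n : ℝ) + 1)))
      + 2 * B * (P.real (J ε n) + P.real (F R n)) := by
    intro ε hε R hR n
    let a : Ω → ℕ → Prop := fun ω k => (∀ j < k, |X (τ n (j + 1)) ω - X (τ n j) ω| ≤ ε) ∧
      ∀ j ≤ k, |X (τ n j) ω| ≤ R
    let b : Ω → ℕ → Prop := fun ω k => |X (τ n (k + 1)) ω - X (τ n k) ω| ≤ ε
    have hab : ∀ ω k, a ω (k + 1) → a ω k ∧ b ω k := fun ω k hk =>
      ⟨⟨fun j hj => hk.1 j (hj.trans (Nat.lt_succ_self k)),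
        fun j hj => hk.2 j (hj.trans (Nat.le_succ k))⟩, hk.1 k (Nat.lt_succ_self k)⟩
    let A : ℕ → Set Ω := fun k => {ω | a ω k}
    let G : ℕ → Set Ω := fun k => {ω | a ω k ∧ ¬ b ω k}
    have hXm : ∀ j k, j ≤ k → Measurable[ℱ (τ n k)] (X (τ n j)) := fun j k hjk =>
      (h.adapted _).mono (ℱ.mono (τm n hjk)) le_rfl
    have hA : ∀ k, MeasurableSet[ℱ (τ n k)] (A k) := by
      intro k
      have : A k = (⋂ j ∈ Finset.range k, {ω | |X (τ n (j + 1)) ω - X (τ n j) ω| ≤ ε}) ∩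
          ⋂ j ∈ Finset.range (k + 1), {ω | |X (τ n j) ω| ≤ R} := by
        ext ω; simp [A, a]
      rw [this]
      refine MeasurableSet.inter ?_ ?_
      · refine Finset.measurableSet_biInter _ fun j hj => ?_
        have hj' := Finset.mem_range.1 hj
        exact measSet_abs_le (ℱ (τ n k)) ((hXm (j + 1) k hj').sub (hXm j k hj'.le)) ε
      · refine Finset.measurableSet_biInter _ fun j hj => ?_
        have hj' := Finset.mem_range.1 hj
        exact measSet_abs_le (ℱ (τ n k)) (hXm j k (Nat.lt_succ_iff.1 hj')) R
    have hG : ∀ k, MeasurableSet[ℱ (τ n (k + 1))] (G k) := by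
      intro k
      have : G k = A k ∩ {ω | |X (τ n (k + 1)) ω - X (τ n k) ω| ≤ ε}ᶜ := by
        ext ω; simp [G, A, b]
      rw [this]
      refine MeasurableSet.inter (ℱ.mono (τm n (Nat.le_succ k)) _ (hA k)) (MeasurableSet.compl ?_)
      exact measSet_abs_le (ℱ (τ n (k + 1)))
        ((hXm (k + 1) (k + 1) le_rfl).sub (hXm k (k + 1) (Nat.le_succ k))) ε
    have hA' : ∀ k, MeasurableSet (A k) := fun k => ℱ.le _ _ (hA k)
    have hG' : ∀ k, MeasurableSet (G k) := fun k => ℱ.le _ _ (hG k)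
    have iN : ∀ t, Integrable (N t) P := fun t =>
      Integrable.of_bound (hN t).aestronglyMeasurable B (ae_of_all _ (hB t))
    have hsqi : ∀ u v, Integrable (fun ω => (X u ω - X v ω) ^ 2) P := fun u v =>
      ((h.memLp u).sub (h.memLp v)).integrable_sq
    set H : Ω → ℝ := fun ω => 4 * M T ω ^ 2 + (4 * c ^ 2 + 2 * R ^ 2) with hH
    have iH : Integrable H P := (hMT.const_mul 4).add (integrable_const _)
    -- step A : telescoping
    have sA : ∫ ω, N T ω ∂P - ∫ ω, N s ω ∂P ≤
        ∑ k ∈ Finset.range (n + 1), ∫ ω in A k, (N (τ n (k + 1)) ω - N (τ n k) ω) ∂P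
        + 2 * B * (P.real (J ε n) + P.real (F R n)) := by
      have iJ : Integrable ((J ε n).indicator (fun _ => (1:ℝ))) P :=
        (integrable_const (1:ℝ)).indicator (hJm ε n)
      have iF : Integrable ((F R n).indicator (fun _ => (1:ℝ))) P :=
        (integrable_const (1:ℝ)).indicator (hFm R n)
      have iS : ∀ k ∈ Finset.range (n + 1), Integrable ((A k).indicator
          (fun ω => N (τ n (k + 1)) ω - N (τ n k) ω)) P := fun k _ =>
        ((iN _).sub (iN _)).indicator (hA' k)
      have hp : ∀ ω, N T ω - N s ω ≤ ∑ k ∈ Finset.range (n + 1),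
          (A k).indicator (fun ω => N (τ n (k + 1)) ω - N (τ n k) ω) ω
          + 2 * B * ((J ε n).indicator (fun _ => (1:ℝ)) ω + (F R n).indicator (fun _ => (1:ℝ)) ω) := by
        intro ω
        obtain ⟨i, hi, hi', he⟩ := telescope_exit (fun k => N (τ n k) ω) (a ω)
          (fun k hk => (hab ω k hk).1) (n + 1)
        have e1 : ∑ k ∈ Finset.range (n + 1),
          (A k).indicator (fun ω => N (τ n (k + 1)) ω - N (τ n k) ω) ω = N (τ n i) ω - N s ω := by
          rw [← τ0 n, ← he]
          refine Finset.sum_congr rfl fun k _ => ?_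
          have hmem : ω ∈ A k ↔ a ω k := Iff.rfl
          by_cases hk : a ω k
          · rw [Set.indicator_of_mem (hmem.2 hk), if_pos hk]
          · rw [Set.indicator_of_notMem (fun hh => hk (hmem.1 hh)), if_neg hk]
        rw [e1]
        have j0 : 0 ≤ (J ε n).indicator (fun _ => (1:ℝ)) ω :=
          Set.indicator_nonneg (fun _ _ => zero_le_one) _
        have f0 : 0 ≤ (F R n).indicator (fun _ => (1:ℝ)) ω :=
          Set.indicator_nonneg (fun _ _ => zero_le_one) _
        by_cases hg : a ω (n + 1)
        · rw [hi' hg, τn]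
          have : 0 ≤ 2 * B * ((J ε n).indicator (fun _ => (1:ℝ)) ω
            + (F R n).indicator (fun _ => (1:ℝ)) ω) := by positivity
          linarith
        · have : 1 ≤ (J ε n).indicator (fun _ => (1:ℝ)) ω + (F R n).indicator (fun _ => (1:ℝ)) ω := by
            simp only [a, not_and_or, not_forall] at hg
            rcases hg with ⟨j, hj, hj'⟩ | ⟨j, hj, hj'⟩
            · have : ω ∈ J ε n := ⟨j, hj, hj'⟩
              rw [Set.indicator_of_mem this]; linarith
            · have : ω ∈ F R n := ⟨j, hj, hj'⟩
              rw [Set.indicator_of_mem this]; linarith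
          have h1 := (abs_le.1 (hB T ω)).2
          have h2 := (abs_le.1 (hB (τ n i) ω)).1
          nlinarith [mul_le_mul_of_nonneg_left this hBp]
      have iR : Integrable (fun ω => 2 * B * ((J ε n).indicator (fun _ => (1:ℝ)) ω
          + (F R n).indicator (fun _ => (1:ℝ)) ω)) P := (iJ.add iF).const_mul _
      have iL : Integrable (fun ω => ∑ k ∈ Finset.range (n + 1),
          (A k).indicator (fun ω => N (τ n (k + 1)) ω - N (τ n k) ω) ω) P :=
        integrable_finsetSum _ iS
      have := integral_mono ((iN T).sub (iN s)) (iL.add iR) hp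
      simp only [Pi.sub_apply, Pi.add_apply] at this
      rw [integral_sub (iN T) (iN s), integral_add iL iR, integral_finsetSum _ iS,
        integral_const_mul, integral_add iJ iF] at this
      simp only [integral_indicator (hA' _), integral_indicator (hJm _ _),
        integral_indicator (hFm _ _)] at this
      simpa using this
    -- step B : one step bound
    have sB : ∀ k ∈ Finset.range (n + 1), ∫ ω in A k, (N (τ n (k + 1)) ω - N (τ n k) ω) ∂P ≤
        C * ((ε * (D * ((T - s) / ((n : ℝ) + 1))) + ∫ ω in G k, H ω ∂P) +
          ((T - s) / ((n : ℝ) + 1)) * √((T - s) / ((n : ℝ) + 1))) := by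
      intro k hk
      have hk' : k + 1 ≤ n + 1 := Finset.mem_range.1 hk
      have := hstep (τ n k) (τ n (k + 1)) (τs n k) (τm n (Nat.le_succ k)) (τT n _ hk') (A k) (hA k)
      rw [τd] at this
      refine this.trans (mul_le_mul_of_nonneg_left (add_le_add ?_ le_rfl) hC)
      have hDk := hD (τ n k) (τ n (k + 1)) (hs.trans (τs n k)) (τm n (Nat.le_succ k)) (τT n _ hk')
      rw [τd] at hDk
      have hMk := h.M_sq_le (τT n _ hk') (hG k)
      set H' : Ω → ℝ := fun ω => 4 * M (τ n (k + 1)) ω ^ 2 + (4 * c ^ 2 + 2 * R ^ 2) with hH'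
      have iH' : Integrable H' P := ((h.M_sq_int _).const_mul 4).add (integrable_const _)
      have hle : ∫ ω in G k, H' ω ∂P ≤ ∫ ω in G k, H ω ∂P := by
        simp only [hH, hH']
        rw [integral_add ((h.M_sq_int _).const_mul 4).integrableOn (integrable_const _).integrableOn,
          integral_add (hMT.const_mul 4).integrableOn (integrable_const _).integrableOn,
          integral_const_mul, integral_const_mul]
        have : ∫ ω in G k, M (τ n (k + 1)) ω ^ 2 ∂P ≤ ∫ ω in G k, M T ω ^ 2 ∂P := hMk
        linarith
      have hp : ∀ ω, (A k).indicator (fun ω => (X (τ n (k + 1)) ω - X (τ n k) ω) ^ 2 *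
          min |X (τ n (k + 1)) ω - X (τ n k) ω| 1) ω ≤
          ε * (X (τ n (k + 1)) ω - X (τ n k) ω) ^ 2 + (G k).indicator H' ω := by
        intro ω
        have g0 : 0 ≤ (G k).indicator H' ω := Set.indicator_nonneg (fun _ _ => by
          simp only [hH']; positivity) _
        set d := X (τ n (k + 1)) ω - X (τ n k) ω with hd
        have d0 : 0 ≤ d ^ 2 := sq_nonneg _
        by_cases h1 : ω ∈ A k
        · rw [Set.indicator_of_mem h1]
          by_cases h2 : |d| ≤ ε
          · have : d ^ 2 * min |d| 1 ≤ d ^ 2 * ε :=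
              mul_le_mul_of_nonneg_left ((min_le_left _ _).trans h2) d0
            linarith
          · have h3 : ω ∈ G k := ⟨h1, h2⟩
            rw [Set.indicator_of_mem h3]
            have h4 : d ^ 2 * min |d| 1 ≤ d ^ 2 * 1 :=
              mul_le_mul_of_nonneg_left (min_le_right _ _) d0
            have h5 : |X (τ n k) ω| ≤ R := h1.2 k le_rfl
            have h6 : X (τ n k) ω ^ 2 ≤ R ^ 2 := sq_le_sq' (abs_le.1 h5).1 (abs_le.1 h5).2
            obtain ⟨c1, c2⟩ := hc (τ n (k + 1)) (hs.trans (τs n _)) (τT n _ hk')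
            set q := x + ∫ r in Set.Ioc (0 : ℝ) (τ n (k + 1)), δ r with hq
            have h7 : X (τ n (k + 1)) ω = M (τ n (k + 1)) ω + q := by
              simp only [hM, hq]; ring
            have h8 : d = M (τ n (k + 1)) ω + q - X (τ n k) ω := by rw [hd, h7]
            have h9 : q ^ 2 ≤ c ^ 2 := pow_le_pow_left₀ c1 c2 2
            have h10 : d ^ 2 ≤ H' ω := by
              simp only [hH']
              rw [h8]
              nlinarith [sq_nonneg (M (τ n (k + 1)) ω + q + X (τ n k) ω),
                sq_nonneg (M (τ n (k + 1)) ω - q)]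
            have : 0 ≤ ε * d ^ 2 := by positivity
            linarith
        · rw [Set.indicator_of_notMem h1]
          positivity
      have ib : Integrable (fun ω => ε * (X (τ n (k + 1)) ω - X (τ n k) ω) ^ 2
        + (G k).indicator H' ω) P := ((hsqi _ _).const_mul ε).add (iH'.indicator (hG' k))
      have hmono := integral_mono_of_nonneg (μ := P) (ae_of_all _ fun ω =>
        Set.indicator_nonneg (s := A k) (f := fun ω => (X (τ n (k + 1)) ω - X (τ n k) ω) ^ 2 *
          min |X (τ n (k + 1)) ω - X (τ n k) ω| 1) (fun ω _ => by positivity) ω) ib (ae_of_all _ hp)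
      rw [integral_indicator (hA' k), integral_add ((hsqi _ _).const_mul ε) (iH'.indicator (hG' k)),
        integral_const_mul, integral_indicator (hG' k)] at hmono
      have := mul_le_mul_of_nonneg_left hDk hε.le
      linarith
    -- step C : sum of exits
    have sC : ∑ k ∈ Finset.range (n + 1), ∫ ω in G k, H ω ∂P ≤ ∫ ω in J ε n, H ω ∂P := by
      simp_rw [← integral_indicator (hG' _), ← integral_indicator (hJm ε n)]
      rw [← integral_finsetSum _ fun k _ => iH.indicator (hG' k)]
      refine integral_mono (integrable_finsetSum _ fun k _ => iH.indicator (hG' k))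
        (iH.indicator (hJm ε n)) fun ω => ?_
      have hω := first_exit_sum (a ω) (b ω) (hab ω) (n + 1)
      have H0 : 0 ≤ H ω := by simp only [hH]; positivity
      have := mul_le_mul_of_nonneg_right hω H0
      rw [Finset.sum_mul] at this
      refine le_trans (le_of_eq ?_) (this.trans (le_of_eq ?_))
      · refine Finset.sum_congr rfl fun k _ => ?_
        simp only [Set.indicator_apply, G, Set.mem_ofPred_eq, ite_mul, one_mul, zero_mul]
      · simp only [Set.indicator_apply, J, b, Set.mem_ofPred_eq, ite_mul, one_mul, zero_mul]
    have sD := Finset.sum_le_sum sB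
    rw [← Finset.mul_sum, Finset.sum_add_distrib, Finset.sum_add_distrib] at sD
    simp only [Finset.sum_const, Finset.card_range, nsmul_eq_mul] at sD
    push_cast at sD
    have e1 : ((n : ℝ) + 1) * (ε * (D * ((T - s) / ((n : ℝ) + 1)))) = ε * (D * (T - s)) := by
      field_simp
    have e2 : ((n : ℝ) + 1) * ((T - s) / ((n : ℝ) + 1) * √((T - s) / ((n : ℝ) + 1)))
        = (T - s) * √((T - s) / ((n : ℝ) + 1)) := by
      rw [← mul_assoc, mul_div_cancel₀ _ (by positivity)]
    rw [e1, e2] at sD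
    have sE := mul_le_mul_of_nonneg_left (add_le_add_left (add_le_add_right sC (ε * (D * (T - s))))
      ((T - s) * √((T - s) / ((n : ℝ) + 1)))) hC
    linarith
  -- limit in n
  have limJ : ∀ ε > 0, ∀ H : Ω → ℝ, Integrable H P →
      Tendsto (fun n => ∫ ω in J ε n, H ω ∂P) atTop (nhds 0) := by
    intro ε hε H iH
    simp_rw [← integral_indicator (hJm ε _)]
    rw [← integral_zero Ω ℝ (μ := P)]
    refine tendsto_integral_of_dominated_convergence (fun ω => |H ω|)
      (fun n => (iH.indicator (hJm ε n)).aestronglyMeasurable) iH.abs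
      (fun n => ae_of_all _ fun ω => ?_) (ae_of_all _ fun ω => ?_)
    · exact norm_indicator_le_norm_self _ _
    · refine tendsto_const_nhds.congr' ?_
      filter_upwards [grid_small (h.cont ω) hsT hε] with n hn
      rw [Set.indicator_of_notMem]
      rintro ⟨k, hk, hk'⟩
      exact hk' (hn k hk)
  have choice : ∀ m : ℕ, ∃ n : ℕ,
      ∫ ω in J (1 / ((m : ℝ) + 1)) n, (4 * M T ω ^ 2 + (4 * c ^ 2 + 2 * ((m : ℝ) + 1) ^ 2)) ∂P
        ≤ 1 / ((m : ℝ) + 1) ∧ P.real (J (1 / ((m : ℝ) + 1)) n) ≤ 1 / ((m : ℝ) + 1) ∧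
      √((T - s) / ((n : ℝ) + 1)) ≤ 1 / ((m : ℝ) + 1) := by
    intro m
    have hε : (0:ℝ) < 1 / ((m : ℝ) + 1) := by positivity
    have l1 := limJ _ hε (fun ω => 4 * M T ω ^ 2 + (4 * c ^ 2 + 2 * ((m : ℝ) + 1) ^ 2))
      ((hMT.const_mul 4).add (integrable_const _))
    have l2 := limJ _ hε (fun _ => 1) (integrable_const _)
    have l3 : Tendsto (fun n : ℕ => √((T - s) / ((n : ℝ) + 1))) atTop (nhds 0) := by
      have := (tendsto_one_div_add_atTop_nhds_zero_nat (𝕜 := ℝ)).const_mul (T - s)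
      have := this.sqrt
      simpa [div_eq_mul_inv] using this
    obtain ⟨n, h1, h2, h3⟩ := ((l1.eventually (ge_mem_nhds hε)).and
      ((l2.eventually (ge_mem_nhds hε)).and (l3.eventually (ge_mem_nhds hε)))).exists
    exact ⟨n, h1, by simpa using h2, h3⟩
  choose ν hν1 hν2 hν3 using choice
  have limF : Tendsto (fun m : ℕ => P.real (F ((m : ℝ) + 1) (ν m))) atTop (nhds 0) := by
    have e : ∀ m : ℕ, P.real (F ((m : ℝ) + 1) (ν m))
        = ∫ ω, (F ((m : ℝ) + 1) (ν m)).indicator (fun _ => (1:ℝ)) ω ∂P := by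
      intro m; rw [integral_indicator (hFm _ _)]; simp
    simp_rw [e]
    rw [← integral_zero Ω ℝ (μ := P)]
    refine tendsto_integral_of_dominated_convergence (fun ω => 1)
      (fun n => ((integrable_const (1:ℝ)).indicator (hFm _ _)).aestronglyMeasurable)
      (integrable_const _)
      (fun n => ae_of_all _ fun ω => ?_) (ae_of_all _ fun ω => ?_)
    · exact (norm_indicator_le_norm_self _ _).trans (by simp)
    · refine tendsto_const_nhds.congr' ?_
      obtain ⟨b, hb⟩ := (isCompact_Icc (a := s) (b := T)).exists_bound_of_continuousOn
        (h.cont ω).continuousOn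
      filter_upwards [(tendsto_natCast_atTop_atTop (R := ℝ)).eventually_ge_atTop b] with m hm
      rw [Set.indicator_of_notMem]
      rintro ⟨k, hk, hk'⟩
      refine hk' ((hb _ ⟨τs _ _, τT _ _ hk⟩).trans ?_)
      linarith
  have l0 := tendsto_one_div_add_atTop_nhds_zero_nat (𝕜 := ℝ)
  have lim : Tendsto (fun m : ℕ => C * (1 / ((m : ℝ) + 1) * (D * (T - s)) + 1 / ((m : ℝ) + 1)
        + (T - s) * (1 / ((m : ℝ) + 1)))
      + 2 * B * (1 / ((m : ℝ) + 1) + P.real (F ((m : ℝ) + 1) (ν m)))) atTop (nhds 0) := by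
    have := ((((l0.mul_const (D * (T - s))).add l0).add (l0.const_mul (T - s))).const_mul C).add
      ((l0.add limF).const_mul (2 * B))
    simpa using this
  have := ge_of_tendsto' lim fun m => (main (1 / ((m : ℝ) + 1)) (by positivity) ((m : ℝ) + 1)
    (by positivity) (ν m)).trans (by
      have := hν1 m
      have := hν2 m
      have := hν3 m
      have : 0 ≤ T - s := by linarith
      gcongr)
  linarith
end GSol

/-- bounded test function for positivity -/
def posG (y : ℝ) : ℝ := (max y 0 / (1 + max y 0)) ^ 3
def posC (y : ℝ) : ℝ := 3 * (max y 0 / (1 + max y 0)) ^ 2 / (1 + max y 0) ^ 2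

lemma posG_nonneg (y : ℝ) : 0 ≤ posG y := by
  have : 0 ≤ max y 0 := le_max_right _ _
  unfold posG; positivity

lemma posC_nonneg (y : ℝ) : 0 ≤ posC y := by
  have : 0 ≤ max y 0 := le_max_right _ _
  unfold posC; positivity

lemma posG_le (y : ℝ) : posG y ≤ 1 := by
  have : 0 ≤ max y 0 := le_max_right _ _
  unfold posG
  refine pow_le_one₀ (by positivity) ?_
  rw [div_le_one (by positivity)]
  linarith

lemma posC_le (y : ℝ) : posC y ≤ 3 := by
  have : 0 ≤ max y 0 := le_max_right _ _
  unfold posC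
  have h1 : max y 0 / (1 + max y 0) ≤ 1 := by
    rw [div_le_one (by positivity)]
    linarith
  have h2 : (max y 0 / (1 + max y 0)) ^ 2 ≤ 1 := pow_le_one₀ (by positivity) h1
  have h3 : 1 ≤ (1 + max y 0) ^ 2 := one_le_pow₀ (by linarith)
  rw [div_le_iff₀ (by positivity)]
  linarith

lemma posG_meas : Measurable posG := by unfold posG; fun_prop
lemma posC_meas : Measurable posC := by unfold posC; fun_prop

lemma posG_taylor (u v : ℝ) : posG v - posG u ≤ posC u * (v - u) +
    (v - u) ^ 2 * (if 0 ≤ u then 3 else 0) + (v - u) ^ 2 * min |v - u| 1 := by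
  have hr : 0 ≤ (v - u) ^ 2 * min |v - u| 1 := by positivity
  split_ifs with hu
  · have hu' : max u 0 = u := max_eq_left hu
    have hcu : posC u = 3 * (u / (1 + u)) ^ 2 / (1 + u) ^ 2 := by rw [posC, hu']
    have hgu : posG u = (u / (1 + u)) ^ 3 := by rw [posG, hu']
    have hu1 : 0 < 1 + u := by linarith
    set w := u / (1 + u) with hw
    have w0 : 0 ≤ w := by positivity
    have w1 : w ≤ 1 := by rw [hw, div_le_one hu1]; linarith
    rcases le_total 0 v with hv | hv
    · have hgv : posG v = (v / (1 + v)) ^ 3 := by rw [posG, max_eq_left hv]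
      have hv1 : 0 < 1 + v := by linarith
      set z := v / (1 + v) with hz
      have z0 : 0 ≤ z := by positivity
      have z1 : z ≤ 1 := by rw [hz, div_le_one hv1]; linarith
      have e1 : z - w = (v - u) / ((1 + u) * (1 + v)) := by rw [hz, hw]; field_simp; ring
      have e2 : (v - u) / (1 + u) ^ 2 - (z - w) = (v - u) ^ 2 / ((1 + u) ^ 2 * (1 + v)) := by
        rw [e1]; field_simp; ring
      have e3 : 0 ≤ (v - u) ^ 2 / ((1 + u) ^ 2 * (1 + v)) := by positivity
      have e4 : (z - w) ^ 2 ≤ (v - u) ^ 2 := by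
        rw [e1, div_pow]
        refine div_le_self (sq_nonneg _) (one_le_pow₀ ?_)
        nlinarith
      have e5 : z ^ 3 - w ^ 3 ≤ 3 * w ^ 2 * (z - w) + 3 * (z - w) ^ 2 := by
        have : z ^ 3 - w ^ 3 = 3 * w ^ 2 * (z - w) + (z - w) ^ 2 * (2 * w + z) := by ring
        rw [this]
        nlinarith [sq_nonneg (z - w)]
      have e6 : 3 * w ^ 2 * (z - w) ≤ 3 * w ^ 2 * ((v - u) / (1 + u) ^ 2) :=
        mul_le_mul_of_nonneg_left (by linarith) (by positivity)
      rw [hgv, hgu, hcu]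
      have e7 : 3 * w ^ 2 * ((v - u) / (1 + u) ^ 2) = 3 * w ^ 2 / (1 + u) ^ 2 * (v - u) := by ring
      linarith
    · have hgv : posG v = 0 := by rw [posG, max_eq_right hv]; norm_num
      have e1 : posC u ≤ 3 * u := by
        rw [hcu]
        have h3 : 1 ≤ (1 + u) ^ 2 := one_le_pow₀ (by linarith)
        have h4 : w ≤ u := div_le_self hu (by linarith)
        rw [div_le_iff₀ (by positivity)]
        nlinarith
      have e2 : posC u * (u - v) ≤ 3 * (u - v) * (u - v) := by
        have : posC u ≤ 3 * (u - v) := by linarith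
        exact mul_le_mul_of_nonneg_right this (by linarith)
      rw [hgv]
      nlinarith [posG_nonneg u]
  · push Not at hu
    have hgu : posG u = 0 := by rw [posG, max_eq_right hu.le]; norm_num
    have hcu : posC u = 0 := by rw [posC, max_eq_right hu.le]; norm_num
    rw [hgu, hcu]
    rcases le_total 0 v with hv | hv
    · have hgv : posG v = (v / (1 + v)) ^ 3 := by rw [posG, max_eq_left hv]
      have hv1 : 0 < 1 + v := by linarith
      set z := v / (1 + v) with hz
      have z0 : 0 ≤ z := by positivity
      have z1 : z ≤ 1 := by rw [hz, div_le_one hv1]; linarith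
      have z2 : z ≤ v - u := (div_le_self hv (by linarith)).trans (by linarith)
      rw [hgv]
      have : z ^ 2 * z ≤ (v - u) ^ 2 * min |v - u| 1 := by
        refine mul_le_mul (pow_le_pow_left₀ z0 z2 2) (le_min (z2.trans (le_abs_self _)) z1) z0
          (sq_nonneg _)
      nlinarith
    · have hgv : posG v = 0 := by rw [posG, max_eq_right hv]; norm_num
      rw [hgv]; linarith

namespace GSol

set_option linter.unusedSectionVars false

variable {Ω : Type*} [m : MeasurableSpace Ω] {P : Measure Ω} [IsProbabilityMeasure P]
  {ℱ : Filtration ℝ m} {δ : ℝ → ℝ} {x : ℝ} {X : ℝ → Ω → ℝ}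

lemma rem_int (h : GSol P ℱ δ x X) (a b : ℝ) :
    Integrable (fun ω => (X b ω - X a ω) ^ 2 * min |X b ω - X a ω| 1) P := by
  have i2 : Integrable (fun ω => (X b ω - X a ω) ^ 2) P :=
    ((h.memLp b).sub (h.memLp a)).integrable_sq
  refine i2.smul_bdd (f := fun ω => min |X b ω - X a ω| 1) 1 ?_ (ae_of_all _ fun ω => ?_)
  · exact ((((h.meas b).sub (h.meas a)).abs).min measurable_const).aestronglyMeasurable
  · rw [Real.norm_of_nonneg (by positivity)]; exact min_le_right _ _

lemma nonneg (h : GSol P ℱ δ x X) {T : ℝ} (hT : 0 ≤ T) : ∀ᵐ ω ∂P, 0 ≤ X T ω := by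
  obtain ⟨C, hC0, hC⟩ := h.step_two ℝ T (K := 3) (by norm_num)
  have hGm : ∀ t, Measurable (fun ω => posG (-X t ω)) := fun t => posG_meas.comp (h.meas t).neg
  have key := h.key_mono (N := fun t ω => posG (-X t ω)) (B := 1) (C := C + 1) le_rfl hT
    (by linarith) hGm (fun t ω => by
      rw [abs_of_nonneg (posG_nonneg _)]; exact posG_le _) (by
    intro a b ha hab hbT A hA
    have hA' := ℱ.le a _ hA
    have hXa := h.adapted a
    set Y1 : Ω → ℝ := A.indicator (fun ω => posC (-X a ω)) with hY1
    set Y2 : Ω → ℝ := A.indicator (fun ω => if 0 ≤ -X a ω then 3 else 0) with hY2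
    have mY1 : StronglyMeasurable[ℱ a] Y1 :=
      ((posC_meas.comp hXa.neg).stronglyMeasurable).indicator hA
    have mY2 : StronglyMeasurable[ℱ a] Y2 := by
      have : Measurable (fun z : ℝ => if 0 ≤ -z then (3:ℝ) else 0) :=
        Measurable.ite (measurableSet_le measurable_const measurable_neg) measurable_const measurable_const
      exact ((this.comp hXa).stronglyMeasurable).indicator hA
    have b1 : ∀ ω, ‖Y1 ω‖ ≤ 3 := fun ω => (norm_indicator_le_norm_self _ _).trans (by
      rw [Real.norm_of_nonneg (posC_nonneg _)]; exact posC_le _)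
    have b2 : ∀ ω, ‖Y2 ω‖ ≤ 3 := fun ω => (norm_indicator_le_norm_self _ _).trans (by
      split_ifs <;> norm_num)
    have s1 := h.step_one ha hab mY1 b1
    have s2 := hC a b ha hab hbT Y2 mY2 b2
    have z2 : ∫ ω, max (X a ω) 0 • Y2 ω ∂P = 0 := by
      refine integral_eq_zero_of_ae (ae_of_all _ fun ω => ?_)
      simp only [Pi.zero_apply]
      by_cases hω : ω ∈ A
      · simp only [hY2, Set.indicator_of_mem hω]
        split_ifs with h0
        · rw [max_eq_right (by linarith), zero_smul]
        · simp
      · simp [hY2, hω]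
    rw [z2, smul_zero, sub_zero] at s2
    have p1 : 0 ≤ ∫ ω, Y1 ω ∂P := integral_nonneg fun ω =>
      Set.indicator_nonneg (fun _ _ => posC_nonneg _) _
    have p2 : 0 ≤ ∫ r in Set.Ioc a b, δ r := setIntegral_nonneg measurableSet_Ioc fun r _ => h.d0 r
    have s1' : 0 ≤ ∫ ω, (X b ω - X a ω) • Y1 ω ∂P := by
      rw [s1, smul_eq_mul]; positivity
    have s2' := (le_abs_self _).trans s2
    have bi : ∀ Y : Ω → ℝ, StronglyMeasurable[ℱ a] Y → (∀ ω, ‖Y ω‖ ≤ 3) → ∀ f : Ω → ℝ, Integrable f P →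
        Integrable (fun ω => f ω • Y ω) P := fun Y hY hK f hf =>
      hf.smul_bdd 3 (hY.mono (ℱ.le a)).aestronglyMeasurable (ae_of_all _ hK)
    have i1 : Integrable (fun ω => (X b ω - X a ω) • Y1 ω) P :=
      bi Y1 mY1 b1 _ ((h.integrable b).sub (h.integrable a))
    have i2 : Integrable (fun ω => (X b ω - X a ω) ^ 2 • Y2 ω) P :=
      bi Y2 mY2 b2 _ ((h.memLp b).sub (h.memLp a)).integrable_sq
    have i3 := (h.rem_int a b).indicator hA'
    have iN : ∀ t, Integrable (fun ω => posG (-X t ω)) P := fun t =>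
      Integrable.of_bound (hGm t).aestronglyMeasurable 1 (ae_of_all _ fun ω => by
        rw [Real.norm_of_nonneg (posG_nonneg _)]; exact posG_le _)
    rw [← integral_indicator hA', ← integral_indicator hA']
    have hp : ∀ ω, A.indicator (fun ω => posG (-X b ω) - posG (-X a ω)) ω ≤
        (-((X b ω - X a ω) • Y1 ω) + (X b ω - X a ω) ^ 2 • Y2 ω) +
        A.indicator (fun ω => (X b ω - X a ω) ^ 2 * min |X b ω - X a ω| 1) ω := by
      intro ω
      by_cases hω : ω ∈ A
      · simp only [hY1, hY2, Set.indicator_of_mem hω, smul_eq_mul]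
        have := posG_taylor (-X a ω) (-X b ω)
        rw [show -X b ω - -X a ω = -(X b ω - X a ω) by ring, neg_sq, abs_neg] at this
        linarith
      · simp [hY1, hY2, hω]
    have i12 : Integrable (fun ω => -((X b ω - X a ω) • Y1 ω) + (X b ω - X a ω) ^ 2 • Y2 ω) P :=
      i1.neg.add i2
    have i0 : Integrable (fun ω => A.indicator (fun ω => posG (-X b ω) - posG (-X a ω)) ω) P :=
      ((iN b).sub (iN a)).indicator hA'
    have i1n : Integrable (fun ω => -((X b ω - X a ω) • Y1 ω)) P := i1.neg
    have hfin := integral_mono i0 (i12.add i3) hp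
    simp only [Pi.add_apply] at hfin
    rw [integral_add i12 i3, integral_add i1n i2, integral_neg] at hfin
    have r0 : 0 ≤ ∫ ω, A.indicator (fun ω => (X b ω - X a ω) ^ 2 * min |X b ω - X a ω| 1) ω ∂P :=
      integral_nonneg fun ω => Set.indicator_nonneg (fun _ _ => by positivity) _
    have q0 : 0 ≤ (b - a) * √(b - a) := mul_nonneg (by linarith) (Real.sqrt_nonneg _)
    have := mul_nonneg hC0 r0
    refine le_trans hfin ?_
    linarith)
  have e0 : ∫ ω, posG (-X 0 ω) ∂P = 0 := by
    simp only [h.init]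
    have : posG (-x) = 0 := by
      rw [posG, max_eq_right (by linarith [h.x0])]; norm_num
    simp [this]
  have e1 : ∫ ω, posG (-X T ω) ∂P = 0 := le_antisymm (key.trans e0.le)
    (integral_nonneg fun _ => posG_nonneg _)
  have iT : Integrable (fun ω => posG (-X T ω)) P :=
      Integrable.of_bound (hGm T).aestronglyMeasurable 1 (ae_of_all _ fun ω => by
        rw [Real.norm_of_nonneg (posG_nonneg _)]; exact posG_le _)
  rw [integral_eq_zero_iff_of_nonneg (fun _ => posG_nonneg _) iT] at e1
  filter_upwards [e1] with ω hω
  by_contra hneg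
  push Not at hneg
  have : 0 < posG (-X T ω) := by
    rw [posG, max_eq_left (by linarith)]
    have : 0 < -X T ω := by linarith
    positivity
  exact this.ne' hω

/-- at negative times, the process is constant -/
lemma neg_time (h : GSol P ℱ δ x X) {r : ℝ} (hr : r ≤ 0) : ∀ᵐ ω ∂P, X r ω = x := by
  have e := h.mart.2 r 0 hr
  have e0 : (fun ω => X 0 ω - x - ∫ s in Set.Ioc (0 : ℝ) 0, δ s) = 0 := by
    ext ω; simp [h.init]
  simp only at e
  rw [e0, condExp_zero] at e
  filter_upwards [e] with ω hω
  have : Set.Ioc (0:ℝ) r = ∅ := Set.Ioc_eq_empty (by linarith)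
  rw [this] at hω
  simp at hω
  linarith
end GSol

/-- solution of the Riccati equation -/
def lapU (l : ℂ) (r : ℝ) : ℂ := l / (1 + 2 * l * r)

lemma lapU_den_re {l : ℂ} (hl : 0 ≤ l.re) {r : ℝ} (hr : 0 ≤ r) : 1 ≤ (1 + 2 * l * r).re := by
  have : (1 + 2 * l * r).re = 1 + 2 * l.re * r := by simp
  rw [this]
  have : 0 ≤ 2 * l.re * r := by positivity
  linarith

lemma lapU_den_norm {l : ℂ} (hl : 0 ≤ l.re) {r : ℝ} (hr : 0 ≤ r) : 1 ≤ ‖1 + 2 * l * r‖ :=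
  (lapU_den_re hl hr).trans (Complex.re_le_norm _)

lemma lapU_den_ne {l : ℂ} (hl : 0 ≤ l.re) {r : ℝ} (hr : 0 ≤ r) : 1 + 2 * l * r ≠ 0 := by
  intro h0
  have := lapU_den_norm hl hr
  rw [h0] at this
  simp at this
  linarith

lemma lapU_norm {l : ℂ} (hl : 0 ≤ l.re) {r : ℝ} (hr : 0 ≤ r) : ‖lapU l r‖ ≤ ‖l‖ := by
  rw [lapU, norm_div]
  exact div_le_self (norm_nonneg _) (lapU_den_norm hl hr)

lemma lapU_re {l : ℂ} (hl : 0 ≤ l.re) {r : ℝ} (hr : 0 ≤ r) : 0 ≤ (lapU l r).re := by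
  rw [lapU, Complex.div_re, ← add_div]
  refine div_nonneg ?_ (Complex.normSq_nonneg _)
  simp
  nlinarith [mul_nonneg (sq_nonneg l.re) hr, mul_nonneg (sq_nonneg l.im) hr]

lemma lapU_sub {l : ℂ} (hl : 0 ≤ l.re) {r q : ℝ} (hr : 0 ≤ r) (hq : 0 ≤ q) :
    lapU l r - lapU l q = 2 * (q - r) * lapU l r * lapU l q := by
  have h1 := lapU_den_ne hl hr
  have h2 := lapU_den_ne hl hq
  unfold lapU
  rw [div_sub_div _ _ h1 h2, show 2 * ((q:ℂ) - r) * (l / (1 + 2 * l * r)) * (l / (1 + 2 * l * q))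
    = (2 * ((q:ℂ) - r) * l * l) / ((1 + 2 * l * r) * (1 + 2 * l * q)) by
      rw [mul_assoc, div_mul_div_comm, mul_div_assoc', ← mul_assoc]]
  congr 1
  ring

lemma lapU_sub_norm {l : ℂ} (hl : 0 ≤ l.re) {r q : ℝ} (hr : 0 ≤ r) (hq : 0 ≤ q) :
    ‖lapU l r - lapU l q‖ ≤ 2 * |q - r| * ‖l‖ ^ 2 := by
  rw [lapU_sub hl hr hq, norm_mul, norm_mul, norm_mul, ← Complex.ofReal_sub, Complex.norm_real,
    Real.norm_eq_abs]
  simp only [Complex.norm_ofNat]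
  have := lapU_norm hl hr
  have := lapU_norm hl hq
  calc 2 * |q - r| * ‖lapU l r‖ * ‖lapU l q‖ ≤ 2 * |q - r| * ‖l‖ * ‖l‖ := by gcongr
    _ = _ := by ring

lemma lapU_zero (l : ℂ) : lapU l 0 = l := by simp [lapU]

lemma lapU_meas (l : ℂ) : Measurable (lapU l) := by
  unfold lapU; fun_prop

lemma norm_exp_neg_le {w : ℂ} (hw : 0 ≤ w.re) : ‖Complex.exp (-w)‖ ≤ 1 := by
  rw [Complex.norm_exp]; simpa using hw

lemma exp_taylor1 {w v : ℂ} (hw : 0 ≤ w.re) (hv : 0 ≤ v.re) :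
    ‖Complex.exp (-w) - Complex.exp (-v) * (1 - (w - v))‖ ≤ 3 * ‖w - v‖ ^ 2 := by
  have h1 := norm_exp_neg_le hw
  have h2 := norm_exp_neg_le hv
  have n0 := norm_nonneg (w - v)
  rcases le_total ‖w - v‖ 1 with h | h
  · have e : Complex.exp (-w) - Complex.exp (-v) * (1 - (w - v))
        = Complex.exp (-v) * (Complex.exp (-(w - v)) - 1 - (-(w - v))) := by
      have : Complex.exp (-w) = Complex.exp (-v) * Complex.exp (-(w - v)) := by
        rw [← Complex.exp_add]; congr 1; ring
      rw [this]; ring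
    rw [e, norm_mul]
    have b := Complex.norm_exp_sub_one_sub_id_le (x := -(w - v)) (by rwa [norm_neg])
    rw [norm_neg] at b
    calc _ ≤ 1 * ‖w - v‖ ^ 2 := by gcongr
      _ ≤ _ := by nlinarith [sq_nonneg ‖w - v‖]
  · have : ‖Complex.exp (-w) - Complex.exp (-v) * (1 - (w - v))‖ ≤ 1 + 1 * (1 + ‖w - v‖) := by
      refine (norm_sub_le _ _).trans ?_
      rw [norm_mul]
      have : ‖1 - (w - v)‖ ≤ 1 + ‖w - v‖ := (norm_sub_le _ _).trans (by simp)
      gcongr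
    nlinarith

lemma exp_taylor2 {w v : ℂ} (hw : 0 ≤ w.re) (hv : 0 ≤ v.re) :
    ‖Complex.exp (-w) - Complex.exp (-v) * (1 - (w - v) + (w - v) ^ 2 / 2)‖
      ≤ 4 * (‖w - v‖ ^ 2 * min ‖w - v‖ 1) := by
  have h1 := norm_exp_neg_le hw
  have h2 := norm_exp_neg_le hv
  have n0 := norm_nonneg (w - v)
  rcases le_total ‖w - v‖ 1 with h | h
  · have e : Complex.exp (-w) - Complex.exp (-v) * (1 - (w - v) + (w - v) ^ 2 / 2)
        = Complex.exp (-v) * (Complex.exp (-(w - v)) - ∑ m ∈ Finset.range 3, (-(w - v)) ^ m / (m.factorial : ℂ)) := by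
      have : Complex.exp (-w) = Complex.exp (-v) * Complex.exp (-(w - v)) := by
        rw [← Complex.exp_add]; congr 1; ring
      rw [this]
      simp [Finset.sum_range_succ, Nat.factorial]
      ring
    rw [e, norm_mul, min_eq_left h]
    have b := Complex.exp_bound (x := -(w - v)) (by rwa [norm_neg]) (n := 3) (by norm_num)
    rw [norm_neg] at b
    norm_num [Nat.factorial] at b
    rw [neg_sub]
    calc _ ≤ 1 * (‖w - v‖ ^ 3 * (2 / 9)) := by gcongr
      _ ≤ _ := by nlinarith [pow_nonneg n0 3]
  · rw [min_eq_right h]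
    have : ‖Complex.exp (-w) - Complex.exp (-v) * (1 - (w - v) + (w - v) ^ 2 / 2)‖
        ≤ 1 + 1 * ((1 + ‖w - v‖) + ‖w - v‖ ^ 2 / 2) := by
      refine (norm_sub_le _ _).trans ?_
      rw [norm_mul]
      have a1 : ‖1 - (w - v)‖ ≤ 1 + ‖w - v‖ := (norm_sub_le _ _).trans (by simp)
      have a2 : ‖(w - v) ^ 2 / 2‖ = ‖w - v‖ ^ 2 / 2 := by simp
      have : ‖1 - (w - v) + (w - v) ^ 2 / 2‖ ≤ (1 + ‖w - v‖) + ‖w - v‖ ^ 2 / 2 :=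
        (norm_add_le _ _).trans (by rw [a2]; linarith)
      gcongr
    nlinarith

lemma combine_step {eb ea Ib Ia y ay d2 v : ℂ} {p h K m L c R1 R2 R3 R4 : ℝ}
    (H1 : ‖Ib - (y - v * p * y + v ^ 2 / 2 * d2)‖ ≤ R1) (H2 : ‖d2 - 4 * h * ay‖ ≤ R2)
    (H3 : ‖Ia - (y + 2 * h * v ^ 2 * ay)‖ ≤ R3) (H4 : ‖ea - eb * (1 - v * p)‖ ≤ R4)
    (hb : ‖eb‖ ≤ 1) (ha : ‖ea‖ ≤ 1) (hy : ‖y‖ ≤ K) (hay : ‖ay‖ ≤ K * m) (hv : ‖v‖ ≤ L)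
    (hp : 0 ≤ p) (hpc : p ≤ c * h) (hh : 0 ≤ h) :
    ‖eb * Ib - ea * Ia‖ ≤ R1 + L ^ 2 / 2 * R2 + R3 + R4 * K
      + (R4 + L * (c * h)) * (2 * h * L ^ 2 * (K * m)) := by
  have e : eb * Ib - ea * Ia = eb * (Ib - (y - v * p * y + v ^ 2 / 2 * d2))
      + eb * (v ^ 2 / 2) * (d2 - 4 * h * ay) - ea * (Ia - (y + 2 * h * v ^ 2 * ay))
      - (ea - eb * (1 - v * p)) * y
      - ((ea - eb * (1 - v * p)) - eb * v * p) * (2 * h * v ^ 2 * ay) := by ring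
  have L0 : 0 ≤ L := (norm_nonneg _).trans hv
  have r2 : 0 ≤ R2 := (norm_nonneg _).trans H2
  have r4 : 0 ≤ R4 := (norm_nonneg _).trans H4
  have K0 : 0 ≤ K := (norm_nonneg _).trans hy
  have km0 : 0 ≤ K * m := (norm_nonneg _).trans hay
  have t1 : ‖eb * (Ib - (y - v * p * y + v ^ 2 / 2 * d2))‖ ≤ 1 * R1 := by
    rw [norm_mul]; gcongr
  have t2 : ‖eb * (v ^ 2 / 2) * (d2 - 4 * h * ay)‖ ≤ 1 * (L ^ 2 / 2) * R2 := by
    rw [norm_mul, norm_mul]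
    have : ‖v ^ 2 / 2‖ ≤ L ^ 2 / 2 := by simp; gcongr
    gcongr
  have t3 : ‖ea * (Ia - (y + 2 * h * v ^ 2 * ay))‖ ≤ 1 * R3 := by
    rw [norm_mul]; gcongr
  have t4 : ‖(ea - eb * (1 - v * p)) * y‖ ≤ R4 * K := by
    rw [norm_mul]; gcongr
  have t5 : ‖((ea - eb * (1 - v * p)) - eb * v * p) * (2 * h * v ^ 2 * ay)‖
      ≤ (R4 + L * (c * h)) * (2 * h * L ^ 2 * (K * m)) := by
    rw [norm_mul]
    have a1 : ‖eb * v * p‖ ≤ 1 * L * (c * h) := by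
      rw [norm_mul, norm_mul, Complex.norm_real, Real.norm_of_nonneg hp]; gcongr
    have a2 : ‖(ea - eb * (1 - v * p)) - eb * v * p‖ ≤ R4 + L * (c * h) :=
      (norm_sub_le _ _).trans (by linarith)
    have a3 : ‖2 * (h:ℂ) * v ^ 2 * ay‖ ≤ 2 * h * L ^ 2 * (K * m) := by
      rw [norm_mul, norm_mul, norm_mul, norm_pow, Complex.norm_real, Real.norm_of_nonneg hh]
      simp only [Complex.norm_ofNat]
      gcongr
    have : 0 ≤ R4 + L * (c * h) := (norm_nonneg _).trans a2
    gcongr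
  rw [e]
  refine (norm_sub_le _ _).trans ?_
  refine (add_le_add (norm_sub_le _ _) le_rfl).trans ?_
  refine (add_le_add (add_le_add (norm_sub_le _ _) le_rfl) le_rfl).trans ?_
  refine (add_le_add (add_le_add (add_le_add (norm_add_le _ _) le_rfl) le_rfl) le_rfl).trans ?_
  linarith

namespace GSol

set_option linter.unusedSectionVars false

variable {Ω : Type*} [m : MeasurableSpace Ω] {P : Measure Ω} [IsProbabilityMeasure P]
  {ℱ : Filtration ℝ m} {δ : ℝ → ℝ} {x : ℝ} {X : ℝ → Ω → ℝ}

lemma key_eq (h : GSol P ℱ δ x X) {s T : ℝ} (hs : 0 ≤ s) (hsT : s ≤ T) {N : ℝ → Ω → ℂ}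
    {B C : ℝ} (hC : 0 ≤ C) (hN : ∀ t, Measurable (N t))
    (hB : ∀ t ω, s ≤ t → t ≤ T → ‖N t ω‖ ≤ B)
    (hstep : ∀ a b, s ≤ a → a ≤ b → b ≤ T → ∀ A, MeasurableSet[ℱ a] A →
      ‖∫ ω in A, (N b ω - N a ω) ∂P‖ ≤
        C * (∫ ω in A, (X b ω - X a ω) ^ 2 * min |X b ω - X a ω| 1 ∂P + (b - a) * √(b - a))) :
    ∫ ω, N T ω ∂P = ∫ ω, N s ω ∂P := by
  have iN : ∀ t, s ≤ t → t ≤ T → Integrable (N t) P := fun t h1 h2 =>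
    Integrable.of_bound (hN t).aestronglyMeasurable B (ae_of_all _ fun ω => hB t ω h1 h2)
  have main : ∀ L : ℂ →L[ℝ] ℝ, (∀ z, |L z| ≤ ‖z‖) → L (∫ ω, N T ω ∂P) ≤ L (∫ ω, N s ω ∂P) := by
    intro L hL
    have key := h.key_mono (N := fun t ω => if s ≤ t ∧ t ≤ T then L (N t ω) else 0)
      (B := max B 0) (C := C) hs hsT hC
      (fun t => by
        split_ifs
        · exact L.measurable.comp (hN t)
        · exact measurable_const)
      (fun t ω => by
        split_ifs with ht
        · exact (hL _).trans ((hB t ω ht.1 ht.2).trans (le_max_left _ _))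
        · simp)
      (by
        intro a b ha hab hbT A hA
        simp only [ha, hab.trans hbT, ha.trans hab, hbT, and_self, if_true]
        refine le_trans ?_ (hstep a b ha hab hbT A hA)
        refine le_trans (le_of_eq ?_) ((le_abs_self _).trans (hL _))
        have ii : IntegrableOn (fun ω => N b ω - N a ω) A P :=
          ((iN b (ha.trans hab) hbT).sub (iN a ha (hab.trans hbT))).integrableOn
        rw [← L.integral_comp_comm ii]
        simp)
    simp only [le_refl, hsT, and_self, if_true] at key
    rwa [L.integral_comp_comm (iN T hsT le_rfl), L.integral_comp_comm (iN s le_rfl hsT)] at key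
  have r1 := main Complex.reCLM (fun z => Complex.abs_re_le_norm z)
  have r2 := main (-Complex.reCLM) (fun z => by simpa using Complex.abs_re_le_norm z)
  have r3 := main Complex.imCLM (fun z => Complex.abs_im_le_norm z)
  have r4 := main (-Complex.imCLM) (fun z => by simpa using Complex.abs_im_le_norm z)
  simp at r1 r2 r3 r4
  exact Complex.ext (le_antisymm r1 r2) (le_antisymm r3 r4)

lemma second_moment (h : GSol P ℱ δ x X) (T : ℝ) : ∃ C : ℝ, 0 ≤ C ∧ ∀ s, 0 ≤ s → s ≤ T →
    ∫ ω, (X s ω) ^ 2 ∂P ≤ C := by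
  obtain ⟨D, hD0, hD⟩ := h.dX_sq T
  refine ⟨2 * (D * |T|) + 2 * x ^ 2, by positivity, fun s hs hsT => ?_⟩
  have i2 : Integrable (fun ω => (X s ω - X 0 ω) ^ 2) P :=
    ((h.memLp s).sub (h.memLp 0)).integrable_sq
  have : ∫ ω, (X s ω) ^ 2 ∂P ≤ ∫ ω, (2 * (X s ω - X 0 ω) ^ 2 + 2 * x ^ 2) ∂P := by
    refine integral_mono (h.memLp s).integrable_sq ((i2.const_mul 2).add (integrable_const _))
      fun ω => ?_
    simp only [h.init]
    nlinarith [sq_nonneg (X s ω - 2 * x)]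
  rw [integral_add (i2.const_mul 2) (integrable_const _), integral_const_mul] at this
  simp only [integral_const, measureReal_def, measure_univ, smul_eq_mul,
    ENNReal.toReal_one, one_mul] at this
  have h1 := hD 0 s le_rfl hs hsT
  have h2 : D * (s - 0) ≤ D * |T| := by gcongr; linarith [le_abs_self T]
  linarith

/-- the exponent integral -/
lemma q_int (h : GSol P ℱ δ x X) {l : ℂ} (hl : 0 ≤ l.re) {s t T : ℝ} (hs : 0 ≤ s) (htT : t ≤ T) :
    IntegrableOn (fun r => (δ r : ℂ) * lapU l (T - r)) (Set.Ioc s t) := by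
  have hd : IntegrableOn (fun r => (δ r : ℂ)) (Set.Ioc s t) := (h.d_int hs).ofReal
  refine Integrable.mul_bdd (c := ‖l‖) hd
    ((lapU_meas l).comp (measurable_const.sub measurable_id)).aestronglyMeasurable ?_
  refine (ae_restrict_iff' measurableSet_Ioc).2 (ae_of_all _ fun r hr => ?_)
  exact lapU_norm hl (by linarith [hr.2])

lemma q_re (h : GSol P ℱ δ x X) {l : ℂ} (hl : 0 ≤ l.re) {s t T : ℝ} (hs : 0 ≤ s) (htT : t ≤ T) :
    0 ≤ (∫ r in Set.Ioc s t, (δ r : ℂ) * lapU l (T - r)).re := by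
  have := Complex.reCLM.integral_comp_comm (h.q_int hl hs htT)
  simp only [Complex.reCLM_apply] at this
  rw [← this]
  refine setIntegral_nonneg measurableSet_Ioc fun r hr => ?_
  rw [Complex.re_ofReal_mul]
  exact mul_nonneg (h.d0 r) (lapU_re hl (by linarith [hr.2]))

lemma q_sub (h : GSol P ℱ δ x X) {l : ℂ} (hl : 0 ≤ l.re) {a b T : ℝ} (ha : 0 ≤ a) (hab : a ≤ b)
    (hbT : b ≤ T) :
    (∫ r in Set.Ioc a T, (δ r : ℂ) * lapU l (T - r)) = (∫ r in Set.Ioc a b, (δ r : ℂ) * lapU l (T - r))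
      + ∫ r in Set.Ioc b T, (δ r : ℂ) * lapU l (T - r) := by
  rw [← Set.Ioc_union_Ioc_eq_Ioc hab hbT, setIntegral_union (Set.Ioc_disjoint_Ioc_of_le le_rfl)
    measurableSet_Ioc (h.q_int hl ha hbT) (h.q_int hl (ha.trans hab) le_rfl)]

/-- (4) -/
lemma q_step (h : GSol P ℱ δ x X) {l : ℂ} (hl : 0 ≤ l.re) (T : ℝ) : ∃ C : ℝ, 0 ≤ C ∧
    ∀ a b, 0 ≤ a → a ≤ b → b ≤ T →
    ‖Complex.exp (-∫ r in Set.Ioc a T, (δ r : ℂ) * lapU l (T - r))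
      - Complex.exp (-∫ r in Set.Ioc b T, (δ r : ℂ) * lapU l (T - r)) *
        (1 - lapU l (T - b) * (∫ r in Set.Ioc a b, δ r : ℝ))‖ ≤ C * (b - a) ^ 2 := by
  obtain ⟨c, hc0, hc⟩ := h.p_bound T
  refine ⟨3 * (‖l‖ * c) ^ 2 + 2 * ‖l‖ ^ 2 * c, by positivity, fun a b ha hab hbT => ?_⟩
  obtain ⟨q1, q2⟩ := hc a b ha hab hbT
  set Qa := ∫ r in Set.Ioc a T, (δ r : ℂ) * lapU l (T - r) with hQa
  set Qb := ∫ r in Set.Ioc b T, (δ r : ℂ) * lapU l (T - r) with hQb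
  set θ := ∫ r in Set.Ioc a b, (δ r : ℂ) * lapU l (T - r) with hθ
  set p := ∫ r in Set.Ioc a b, δ r with hp
  have e : Qa = θ + Qb := h.q_sub hl ha hab hbT
  have ra : 0 ≤ Qa.re := h.q_re hl ha le_rfl
  have rb : 0 ≤ Qb.re := h.q_re hl (ha.trans hab) le_rfl
  have hh : 0 ≤ b - a := by linarith
  have nθ : ‖θ‖ ≤ ‖l‖ * p := by
    have : ‖θ‖ ≤ ∫ r in Set.Ioc a b, ‖l‖ * δ r := by
      refine norm_integral_le_of_norm_le ((h.d_int ha).const_mul _) ?_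
      refine (ae_restrict_iff' measurableSet_Ioc).2 (ae_of_all _ fun r hr => ?_)
      rw [norm_mul, Complex.norm_real, Real.norm_of_nonneg (h.d0 r), mul_comm]
      exact mul_le_mul_of_nonneg_right (lapU_norm hl (by linarith [hr.2])) (h.d0 r)
    rwa [integral_const_mul] at this
  have nd : ‖θ - lapU l (T - b) * p‖ ≤ 2 * (b - a) * ‖l‖ ^ 2 * p := by
    have e1 : lapU l (T - b) * p = ∫ r in Set.Ioc a b, (δ r : ℂ) * lapU l (T - b) := by
      rw [integral_mul_const, hp, integral_complex_ofReal, mul_comm]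
    have i2 : IntegrableOn (fun r => (δ r : ℂ) * lapU l (T - b)) (Set.Ioc a b) :=
      (h.d_int ha).ofReal.mul_const _
    rw [e1, hθ, ← integral_sub (h.q_int hl ha hbT) i2]
    have : ‖∫ r in Set.Ioc a b, ((δ r : ℂ) * lapU l (T - r) - (δ r : ℂ) * lapU l (T - b))‖
        ≤ ∫ r in Set.Ioc a b, (2 * (b - a) * ‖l‖ ^ 2) * δ r := by
      refine norm_integral_le_of_norm_le ((h.d_int ha).const_mul _) ?_
      refine (ae_restrict_iff' measurableSet_Ioc).2 (ae_of_all _ fun r hr => ?_)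
      rw [← mul_sub, norm_mul, Complex.norm_real, Real.norm_of_nonneg (h.d0 r), mul_comm]
      refine mul_le_mul_of_nonneg_right ?_ (h.d0 r)
      refine (lapU_sub_norm hl (by linarith [hr.2]) (by linarith)).trans ?_
      have : |T - b - (T - r)| ≤ b - a := by rw [abs_le]; constructor <;> linarith [hr.1, hr.2]
      gcongr
    rwa [integral_const_mul] at this
  have t := exp_taylor1 ra rb
  rw [show Qa - Qb = θ by rw [e]; ring] at t
  have e2 : Complex.exp (-Qa) - Complex.exp (-Qb) * (1 - lapU l (T - b) * p)
      = (Complex.exp (-Qa) - Complex.exp (-Qb) * (1 - θ)) - Complex.exp (-Qb) * (θ - lapU l (T - b) * p) := by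
    ring
  rw [e2]
  refine (norm_sub_le _ _).trans ?_
  have t2 : ‖Complex.exp (-Qb) * (θ - lapU l (T - b) * p)‖ ≤ 1 * (2 * (b - a) * ‖l‖ ^ 2 * p) := by
    rw [norm_mul]
    have := norm_exp_neg_le rb
    gcongr
  have t3 : ‖θ‖ ≤ ‖l‖ * (c * (b - a)) := nθ.trans (by gcongr)
  have t4 : 3 * ‖θ‖ ^ 2 ≤ 3 * (‖l‖ * (c * (b - a))) ^ 2 := by gcongr
  have t5 : 2 * (b - a) * ‖l‖ ^ 2 * p ≤ 2 * (b - a) * ‖l‖ ^ 2 * (c * (b - a)) := by gcongr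
  nlinarith
end GSol

namespace GSol

set_option linter.unusedSectionVars false

variable {Ω : Type*} [m : MeasurableSpace Ω] {P : Measure Ω} [IsProbabilityMeasure P]
  {ℱ : Filtration ℝ m} {δ : ℝ → ℝ} {x : ℝ} {X : ℝ → Ω → ℝ}

lemma lapH1 (h : GSol P ℱ δ x X) {a b : ℝ} (ha : 0 ≤ a) (hab : a ≤ b) {v : ℂ} (hv : 0 ≤ v.re)
    {L : ℝ} (hL : ‖v‖ ≤ L) {Z : Ω → ℂ} (hZ : StronglyMeasurable[ℱ a] Z) {K : ℝ}
    (hK : ∀ ω, ‖Z ω‖ ≤ K) (A : Set Ω) (hA : MeasurableSet[ℱ a] A) :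
    ‖(∫ ω, A.indicator Z ω * Complex.exp (-(v * (max (X b ω) 0 : ℝ))) ∂P)
      - ((∫ ω, A.indicator Z ω * Complex.exp (-(v * (max (X a ω) 0 : ℝ))) ∂P)
        - v * (∫ r in Set.Ioc a b, δ r : ℝ) *
          (∫ ω, A.indicator Z ω * Complex.exp (-(v * (max (X a ω) 0 : ℝ))) ∂P)
        + v ^ 2 / 2 * ∫ ω, (X b ω - X a ω) ^ 2 •
          (A.indicator Z ω * Complex.exp (-(v * (max (X a ω) 0 : ℝ)))) ∂P)‖
      ≤ (K * (4 * (1 + L) ^ 3)) *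
        ∫ ω in A, (X b ω - X a ω) ^ 2 * min |X b ω - X a ω| 1 ∂P := by
  have mA : MeasurableSet A := ℱ.le a _ hA
  set W := A.indicator Z with hW
  have sW : StronglyMeasurable[ℱ a] W := hZ.indicator hA
  have K0 : ∀ ω, 0 ≤ K := fun ω => (norm_nonneg _).trans (hK ω)
  have L0 : 0 ≤ L := (norm_nonneg _).trans hL
  have nW : ∀ ω, ‖W ω‖ ≤ K := fun ω => (norm_indicator_le_norm_self _ _).trans (hK ω)
  set Y : Ω → ℂ := fun ω => W ω * Complex.exp (-(v * (max (X a ω) 0 : ℝ))) with hY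
  have re0 : ∀ r : ℝ, 0 ≤ (v * (max r 0 : ℝ)).re := fun r => by
    rw [Complex.re_mul_ofReal]; exact mul_nonneg hv (le_max_right _ _)
  have sY : StronglyMeasurable[ℱ a] Y := by
    refine sW.mul (Measurable.stronglyMeasurable ?_)
    have := h.adapted a
    fun_prop
  have nY : ∀ ω, ‖Y ω‖ ≤ K := fun ω => by
    rw [hY]; simp only [norm_mul]
    calc _ ≤ K * 1 := mul_le_mul (nW ω) (norm_exp_neg_le (re0 _)) (norm_nonneg _) (K0 ω)
      _ = K := mul_one _
  have mY : AEStronglyMeasurable Y P := (sY.mono (ℱ.le a)).aestronglyMeasurable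
  have iY : Integrable Y P := Integrable.of_bound mY K (ae_of_all _ nY)
  have bi : ∀ f : Ω → ℝ, Integrable f P → Integrable (fun ω => f ω • Y ω) P := fun f hf =>
    hf.smul_bdd K mY (ae_of_all _ nY)
  have i1 : Integrable (fun ω => (X b ω - X a ω) • Y ω) P := bi _ ((h.integrable b).sub (h.integrable a))
  have i2 : Integrable (fun ω => (X b ω - X a ω) ^ 2 • Y ω) P :=
    bi _ ((h.memLp b).sub (h.memLp a)).integrable_sq
  have mb := h.meas b
  have mW : AEStronglyMeasurable W P := (sW.mono (ℱ.le a)).aestronglyMeasurable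
  have ib : Integrable (fun ω => W ω * Complex.exp (-(v * (max (X b ω) 0 : ℝ)))) P := by
    refine Integrable.of_bound (mW.mul (Measurable.aestronglyMeasurable (by fun_prop))) K
      (ae_of_all _ fun ω => ?_)
    rw [norm_mul]
    calc _ ≤ K * 1 := mul_le_mul (nW ω) (norm_exp_neg_le (re0 _)) (norm_nonneg _) (K0 ω)
      _ = K := mul_one _
  have s1 := h.step_one ha hab sY nY
  rw [Complex.real_smul] at s1
  have i3 : Integrable (fun ω => Y ω - v * (X b ω - X a ω) • Y ω) P := iY.sub (i1.const_mul v)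
  have i4 : Integrable (fun ω => Y ω - v * (X b ω - X a ω) • Y ω
      + v ^ 2 / 2 * (X b ω - X a ω) ^ 2 • Y ω) P := i3.add (i2.const_mul _)
  change ‖_ - ((∫ ω, Y ω ∂P) - v * ((∫ r in Set.Ioc a b, δ r : ℝ) : ℂ) * (∫ ω, Y ω ∂P) +
    v ^ 2 / 2 * ∫ ω, (X b ω - X a ω) ^ 2 • Y ω ∂P)‖ ≤ _
  rw [mul_assoc v, ← s1, ← integral_const_mul, ← integral_const_mul,
    ← integral_sub iY (i1.const_mul v), ← integral_add i3 (i2.const_mul _),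
    ← integral_sub ib i4, ← integral_const_mul, ← integral_indicator mA]
  refine norm_integral_le_of_norm_le ?_ ?_
  · exact ((h.rem_int a b).const_mul _).indicator mA
  filter_upwards [h.nonneg ha, h.nonneg (ha.trans hab)] with ω p1 p2
  simp only [hY]
  by_cases hω : ω ∈ A
  · simp only [hW, Set.indicator_of_mem hω]
    rw [max_eq_left p1, max_eq_left p2]
    have r1 : 0 ≤ (v * (X a ω : ℝ)).re := by have := re0 (X a ω); rwa [max_eq_left p1] at this
    have r2 : 0 ≤ (v * (X b ω : ℝ)).re := by have := re0 (X b ω); rwa [max_eq_left p2] at this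
    have t := exp_taylor2 r2 r1
    have e : v * (X b ω : ℝ) - v * (X a ω : ℝ) = v * ((X b ω - X a ω : ℝ) : ℂ) := by push_cast; ring
    rw [e] at t
    have e2 : Z ω * Complex.exp (-(v * (X b ω : ℝ))) - (Z ω * Complex.exp (-(v * (X a ω : ℝ)))
        - v * (X b ω - X a ω) • (Z ω * Complex.exp (-(v * (X a ω : ℝ))))
        + v ^ 2 / 2 * (X b ω - X a ω) ^ 2 • (Z ω * Complex.exp (-(v * (X a ω : ℝ)))))
        = Z ω * (Complex.exp (-(v * (X b ω : ℝ))) - Complex.exp (-(v * (X a ω : ℝ))) *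
          (1 - v * ((X b ω - X a ω : ℝ) : ℂ) + (v * ((X b ω - X a ω : ℝ) : ℂ)) ^ 2 / 2)) := by
      simp only [Complex.real_smul]; push_cast; ring
    rw [e2, norm_mul, mul_assoc]
    refine mul_le_mul (hK ω) (t.trans ?_) (norm_nonneg _) (K0 ω)
    rw [norm_mul, Complex.norm_real, Real.norm_eq_abs, mul_assoc]
    refine mul_le_mul_of_nonneg_left ?_ (by norm_num)
    set d := |X b ω - X a ω| with hd
    have d0 : 0 ≤ d := abs_nonneg _
    have hL1 : ‖v‖ ≤ 1 + L := by linarith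
    have m1 : min (‖v‖ * d) 1 ≤ (1 + L) * min d 1 := by
      rcases le_total d 1 with q | q
      · rw [min_eq_left q]; exact (min_le_left _ _).trans (by gcongr)
      · rw [min_eq_right q]; exact (min_le_right _ _).trans (by linarith)
    rw [← sq_abs (X b ω - X a ω), ← hd]
    calc (‖v‖ * d) ^ 2 * min (‖v‖ * d) 1 ≤ ((1 + L) * d) ^ 2 * ((1 + L) * min d 1) := by gcongr
      _ = _ := by ring
  · simp [hW, Set.indicator_of_notMem hω]

lemma lapH3 (h : GSol P ℱ δ x X) {a : ℝ} (ha : 0 ≤ a) {v w : ℂ} (hv : 0 ≤ v.re) (hw : 0 ≤ w.re)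
    {η L : ℝ} (hη : 0 ≤ η) (hL : ‖v‖ ≤ L) (hL' : ‖w‖ ≤ L) (hvw : v - w = 2 * η * v * w)
    {W : Ω → ℂ} (mW : AEStronglyMeasurable W P) {K : ℝ}
    (nW : ∀ ω, ‖W ω‖ ≤ K) {m1 m2 : ℝ} (h1 : ∫ ω, |X a ω| ∂P ≤ m1) (h2 : ∫ ω, (X a ω) ^ 2 ∂P ≤ m2) :
    ‖(∫ ω, W ω * Complex.exp (-(w * (max (X a ω) 0 : ℝ))) ∂P)
      - ((∫ ω, W ω * Complex.exp (-(v * (max (X a ω) 0 : ℝ))) ∂P)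
        + 2 * η * v ^ 2 * ∫ ω, (max (X a ω) 0) •
          (W ω * Complex.exp (-(v * (max (X a ω) 0 : ℝ)))) ∂P)‖
      ≤ K * (12 * L ^ 4 * m2 + 4 * L ^ 3 * m1) * η ^ 2 := by
  have K0 : 0 ≤ K := by
    have : Nonempty Ω := nonempty_of_isProbabilityMeasure P
    exact (norm_nonneg _).trans (nW (Classical.arbitrary Ω))
  have L0 : 0 ≤ L := (norm_nonneg _).trans hL
  have re0 : ∀ v : ℂ, 0 ≤ v.re → ∀ r : ℝ, 0 ≤ (v * (max r 0 : ℝ)).re := fun v hv r => by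
    rw [Complex.re_mul_ofReal]; exact mul_nonneg hv (le_max_right _ _)
  have ma := h.meas a
  have mm : ∀ v : ℂ, AEStronglyMeasurable
      (fun ω => W ω * Complex.exp (-(v * (max (X a ω) 0 : ℝ)))) P := fun v =>
    mW.mul (Measurable.aestronglyMeasurable (by fun_prop))
  have nn : ∀ v : ℂ, 0 ≤ v.re → ∀ ω, ‖W ω * Complex.exp (-(v * (max (X a ω) 0 : ℝ)))‖ ≤ K := by
    intro v hv ω
    rw [norm_mul]
    calc _ ≤ K * 1 := mul_le_mul (nW ω) (norm_exp_neg_le (re0 v hv _)) (norm_nonneg _) K0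
      _ = K := mul_one _
  have ii : ∀ v : ℂ, 0 ≤ v.re → Integrable
      (fun ω => W ω * Complex.exp (-(v * (max (X a ω) 0 : ℝ)))) P := fun v hv =>
    Integrable.of_bound (mm v) K (ae_of_all _ (nn v hv))
  have i2 : Integrable (fun ω => (max (X a ω) 0) •
          (W ω * Complex.exp (-(v * (max (X a ω) 0 : ℝ))))) P :=
    (h.integrable a).pos_part.smul_bdd K (mm v) (ae_of_all _ (nn v hv))
  have i4 : Integrable (fun ω => W ω * Complex.exp (-(v * (max (X a ω) 0 : ℝ))) +
      2 * η * v ^ 2 * (max (X a ω) 0) •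
          (W ω * Complex.exp (-(v * (max (X a ω) 0 : ℝ))))) P := (ii v hv).add (i2.const_mul _)
  rw [← integral_const_mul, ← integral_add (ii v hv) (i2.const_mul _),
    ← integral_sub (ii w hw) i4]
  have j1 : Integrable (fun ω => 12 * L ^ 4 * (X a ω) ^ 2) P := (h.memLp a).integrable_sq.const_mul _
  have j2 : Integrable (fun ω => 4 * L ^ 3 * |X a ω|) P := (h.integrable a).abs.const_mul _
  have main : ‖∫ ω, (W ω * Complex.exp (-(w * (max (X a ω) 0 : ℝ))) -
      (W ω * Complex.exp (-(v * (max (X a ω) 0 : ℝ))) + 2 * η * v ^ 2 * (max (X a ω) 0) •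
          (W ω * Complex.exp (-(v * (max (X a ω) 0 : ℝ)))))) ∂P‖
      ≤ ∫ ω, (K * η ^ 2) * (12 * L ^ 4 * (X a ω) ^ 2 + 4 * L ^ 3 * |X a ω|) ∂P := by
    refine norm_integral_le_of_norm_le ((j1.add j2).const_mul _) (ae_of_all _ fun ω => ?_)
    have t := exp_taylor1 (re0 w hw (X a ω)) (re0 v hv (X a ω))
    have q1 : max (X a ω) 0 ≤ |X a ω| := max_le (le_abs_self _) (abs_nonneg _)
    set α := max (X a ω) 0 with hα
    have α0 : 0 ≤ α := le_max_right _ _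
    have q2 : α ^ 2 ≤ X a ω ^ 2 := by rw [← sq_abs (X a ω)]; gcongr
    have e2 : W ω * Complex.exp (-(w * α)) - (W ω * Complex.exp (-(v * α)) + 2 * η * v ^ 2 * α •
          (W ω * Complex.exp (-(v * α)))) = W ω * ((Complex.exp (-(w * α)) -
            Complex.exp (-(v * α)) * (1 - (w * α - v * α))) +
              Complex.exp (-(v * α)) * (2 * η * v * α * -(2 * η * v * w))) := by
      simp only [Complex.real_smul]
      linear_combination W ω * Complex.exp (-(v * α)) * α * (1 - 2 * η * v) * hvw
    rw [e2, norm_mul, mul_assoc K]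
    refine mul_le_mul (nW ω) ?_ (norm_nonneg _) K0
    refine (norm_add_le _ _).trans ?_
    have n1 : ‖2 * (η : ℂ) * v * w‖ ≤ 2 * η * L * L := by
      rw [norm_mul, norm_mul, norm_mul, Complex.norm_real, Real.norm_of_nonneg hη]
      simp only [Complex.norm_ofNat]
      gcongr
    have n2 : ‖w * (α : ℂ) - v * α‖ ≤ 2 * η * L * L * α := by
      rw [show w * (α : ℂ) - v * α = -((v - w) * α) by ring, hvw, norm_neg, norm_mul,
        Complex.norm_real, Real.norm_of_nonneg α0]
      gcongr
    have n3 : ‖2 * (η : ℂ) * v * α‖ ≤ 2 * η * L * α := by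
      rw [norm_mul, norm_mul, norm_mul, Complex.norm_real, Complex.norm_real,
        Real.norm_of_nonneg hη, Real.norm_of_nonneg α0]
      simp only [Complex.norm_ofNat]
      gcongr
    have n4 : ‖Complex.exp (-(v * α)) * (2 * η * v * α * -(2 * η * v * w))‖
        ≤ 1 * ((2 * η * L * α) * (2 * η * L * L)) := by
      rw [norm_mul, norm_mul, norm_neg]
      exact mul_le_mul (norm_exp_neg_le (re0 v hv (X a ω)))
        (mul_le_mul n3 n1 (norm_nonneg _) (by positivity)) (by positivity) (by norm_num)
    have n5 : 3 * ‖w * (α : ℂ) - v * α‖ ^ 2 ≤ 3 * (2 * η * L * L * α) ^ 2 := by gcongr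
    calc _ ≤ 3 * (2 * η * L * L * α) ^ 2 + 1 * ((2 * η * L * α) * (2 * η * L * L)) := by linarith
      _ = η ^ 2 * (12 * L ^ 4 * α ^ 2 + 4 * L ^ 3 * α) := by ring
      _ ≤ _ := by gcongr
  refine main.trans ?_
  rw [integral_const_mul, integral_add j1 j2, integral_const_mul, integral_const_mul]
  calc _ ≤ K * η ^ 2 * (12 * L ^ 4 * m2 + 4 * L ^ 3 * m1) := by gcongr
    _ = _ := by ring

end GSol

namespace GSol

set_option linter.unusedSectionVars false

variable {Ω : Type*} [m : MeasurableSpace Ω] {P : Measure Ω} [IsProbabilityMeasure P]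
  {ℱ : Filtration ℝ m} {δ : ℝ → ℝ} {x : ℝ} {X : ℝ → Ω → ℝ}

lemma fin2 (C S J g : ℝ) (hS : 0 ≤ S) (hJ : 0 ≤ J) (hg : 0 ≤ C * g) :
    C * J + S * g ≤ (C + S) * (J + g) := by
  nlinarith [mul_nonneg hS hJ]

set_option maxHeartbeats 1000000 in
lemma laplace_step (h : GSol P ℱ δ x X) {s T : ℝ} (hs : 0 ≤ s) (hsT : s ≤ T) {l : ℂ} (hl : 0 ≤ l.re)
    {Z : Ω → ℂ} (hZ : StronglyMeasurable[ℱ s] Z) {K : ℝ} (hK : ∀ ω, ‖Z ω‖ ≤ K) :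
    ∃ C : ℝ, 0 ≤ C ∧ ∀ a b, s ≤ a → a ≤ b → b ≤ T → ∀ A, MeasurableSet[ℱ a] A →
      ‖Complex.exp (-∫ r in Set.Ioc b T, (δ r : ℂ) * lapU l (T - r)) *
          (∫ ω, A.indicator Z ω * Complex.exp (-(lapU l (T - b) * (max (X b ω) 0 : ℝ))) ∂P)
        - Complex.exp (-∫ r in Set.Ioc a T, (δ r : ℂ) * lapU l (T - r)) *
          (∫ ω, A.indicator Z ω * Complex.exp (-(lapU l (T - a) * (max (X a ω) 0 : ℝ))) ∂P)‖ ≤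
        C * (∫ ω in A, (X b ω - X a ω) ^ 2 * min |X b ω - X a ω| 1 ∂P + (b - a) * √(b - a)) := by
  have K0 : 0 ≤ K := by
    have : Nonempty Ω := nonempty_of_isProbabilityMeasure P
    exact (norm_nonneg _).trans (hK (Classical.arbitrary Ω))
  have T0 : 0 ≤ T := hs.trans hsT
  obtain ⟨c, hc0, hc⟩ := h.p_bound T
  obtain ⟨m1, hm10, hm1⟩ := h.first_moment T
  obtain ⟨m2, hm20, hm2⟩ := h.second_moment T
  obtain ⟨C2, hC20, hC2⟩ := h.step_two ℂ T K0
  obtain ⟨C4, hC40, hC4⟩ := h.q_step hl T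
  set L := ‖l‖ with hL
  have L0 : 0 ≤ L := norm_nonneg _
  set C1 := K * (4 * (1 + L) ^ 3) with hC1
  set C3 := K * (12 * L ^ 4 * m2 + 4 * L ^ 3 * m1) with hC3
  have C10 : 0 ≤ C1 := by positivity
  have C30 : 0 ≤ C3 := by positivity
  refine ⟨C1 + (L ^ 2 / 2 * C2 + (C3 + C4 * K + (C4 * T + L * c) * (2 * L ^ 2 * (K * m1))) * √T),
    by positivity, fun a b hsa hab hbT A hA => ?_⟩
  have ha : 0 ≤ a := hs.trans hsa
  have haT : a ≤ T := hab.trans hbT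
  have hZa : StronglyMeasurable[ℱ a] Z := hZ.mono (ℱ.mono hsa)
  have hη : 0 ≤ b - a := by linarith
  have vb : 0 ≤ T - b := by linarith
  have va : 0 ≤ T - a := by linarith
  have hv := lapU_re hl vb
  have hw := lapU_re hl va
  have nv := lapU_norm hl vb
  have nw := lapU_norm hl va
  have vw : lapU l (T - b) - lapU l (T - a) = 2 * ((b - a : ℝ) : ℂ) * lapU l (T - b) * lapU l (T - a) := by
    rw [lapU_sub hl vb va]; push_cast; ring
  have re0 : ∀ r : ℝ, 0 ≤ (lapU l (T - b) * (max r 0 : ℝ)).re := fun r => by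
    rw [Complex.re_mul_ofReal]; exact mul_nonneg hv (le_max_right _ _)
  have mA : MeasurableSet A := ℱ.le a _ hA
  have sW : StronglyMeasurable[ℱ a] (A.indicator Z) := hZa.indicator hA
  have nW : ∀ ω, ‖A.indicator Z ω‖ ≤ K := fun ω => (norm_indicator_le_norm_self _ _).trans (hK ω)
  have sY : StronglyMeasurable[ℱ a] (fun ω => A.indicator Z ω * Complex.exp (-(lapU l (T - b) * (max (X a ω) 0 : ℝ)))) := by
    refine sW.mul (Measurable.stronglyMeasurable ?_)
    have := h.adapted a
    fun_prop
  have nY : ∀ ω, ‖A.indicator Z ω * Complex.exp (-(lapU l (T - b) * (max (X a ω) 0 : ℝ)))‖ ≤ K := fun ω => by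
    simp only [norm_mul]
    calc _ ≤ K * 1 := mul_le_mul (nW ω) (norm_exp_neg_le (re0 _)) (norm_nonneg _) K0
      _ = K := mul_one _
  have H1 := h.lapH1 ha hab hv nv hZa hK A hA
  have H2 := hC2 a b ha hab hbT _ sY nY
  have H3 := h.lapH3 ha hv hw hη nv nw vw (sW.mono (ℱ.le a)).aestronglyMeasurable nW
    (hm1 a ha haT) (hm2 a ha haT)
  have H4 := hC4 a b ha hab hbT
  have H5 : ‖∫ ω, A.indicator Z ω * Complex.exp (-(lapU l (T - b) * (max (X a ω) 0 : ℝ))) ∂P‖ ≤ K := by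
    have := norm_integral_le_of_norm_le_const (μ := P) (ae_of_all _ nY)
    simpa using this
  have H6 : ‖∫ ω, max (X a ω) 0 • (A.indicator Z ω * Complex.exp (-(lapU l (T - b) * (max (X a ω) 0 : ℝ)))) ∂P‖
      ≤ K * m1 := by
    refine le_trans ?_ (mul_le_mul_of_nonneg_left (hm1 a ha haT) K0)
    rw [← integral_const_mul]
    refine norm_integral_le_of_norm_le ((h.integrable a).abs.const_mul _) (ae_of_all _ fun ω => ?_)
    rw [norm_smul, Real.norm_of_nonneg (le_max_right _ _), mul_comm]
    exact mul_le_mul (nY ω) (max_le (le_abs_self _) (abs_nonneg _)) (le_max_right _ _) K0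
  have ra : 0 ≤ (∫ r in Set.Ioc a T, (δ r : ℂ) * lapU l (T - r)).re := h.q_re hl ha le_rfl
  have rb : 0 ≤ (∫ r in Set.Ioc b T, (δ r : ℂ) * lapU l (T - r)).re :=
    h.q_re hl (ha.trans hab) le_rfl
  rw [Complex.real_smul] at H2
  push_cast at H2
  rw [← Complex.ofReal_sub] at H2
  have fin := combine_step H1 H2 H3 H4 (norm_exp_neg_le rb) (norm_exp_neg_le ra) H5 H6 nv
    (hc a b ha hab hbT).1 (hc a b ha hab hbT).2 hη
  refine fin.trans ?_
  have J0 : 0 ≤ ∫ ω in A, (X b ω - X a ω) ^ 2 * min |X b ω - X a ω| 1 ∂P :=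
    setIntegral_nonneg mA fun ω _ => by positivity
  set J := ∫ ω in A, (X b ω - X a ω) ^ 2 * min |X b ω - X a ω| 1 ∂P
  set η := b - a with hηd
  have ηT : η ≤ T := by linarith
  set g := η * √η with hg
  have g0 : 0 ≤ g := by positivity
  have e2 : η ^ 2 ≤ √T * g := by
    have : η ^ 2 = √η * g := by
      rw [hg, mul_left_comm, Real.mul_self_sqrt hη]; ring
    rw [this]
    have := Real.sqrt_le_sqrt ηT
    gcongr
  have q1 : (C4 * η ^ 2 + L * (c * η)) * (2 * η * L ^ 2 * (K * m1))
      ≤ (C4 * T + L * c) * (2 * L ^ 2 * (K * m1)) * (√T * g) := by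
    calc _ = (C4 * η + L * c) * (2 * L ^ 2 * (K * m1)) * η ^ 2 := by ring
      _ ≤ _ := by gcongr
  have q2 : C3 * η ^ 2 ≤ C3 * (√T * g) := by gcongr
  have q3 : C4 * η ^ 2 * K ≤ C4 * (√T * g) * K := by gcongr
  have S0 : 0 ≤ L ^ 2 / 2 * C2 + (C3 + C4 * K + (C4 * T + L * c) * (2 * L ^ 2 * (K * m1))) * √T := by
    positivity
  have q4 := mul_nonneg C10 g0
  calc _ ≤ C1 * J + L ^ 2 / 2 * (C2 * g) + C3 * (√T * g) + C4 * (√T * g) * K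
        + (C4 * T + L * c) * (2 * L ^ 2 * (K * m1)) * (√T * g) := by
        refine add_le_add (add_le_add (add_le_add le_rfl q2) q3) q1
    _ = C1 * J + (L ^ 2 / 2 * C2 + (C3 + C4 * K + (C4 * T + L * c) * (2 * L ^ 2 * (K * m1))) * √T) * g := by
        ring
    _ ≤ _ := fin2 C1 _ J g S0 J0 q4

/-- conditional Laplace transform -/
lemma laplace (h : GSol P ℱ δ x X) {s T : ℝ} (hs : 0 ≤ s) (hsT : s ≤ T) {l : ℂ} (hl : 0 ≤ l.re)
    {Z : Ω → ℂ} (hZ : StronglyMeasurable[ℱ s] Z) {K : ℝ} (hK : ∀ ω, ‖Z ω‖ ≤ K) :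
    ∫ ω, Z ω * Complex.exp (-(l * (X T ω : ℝ))) ∂P
      = (∫ ω, Z ω * Complex.exp (-(lapU l (T - s) * (X s ω : ℝ))) ∂P)
        * Complex.exp (-∫ r in Set.Ioc s T, (δ r : ℂ) * lapU l (T - r)) := by
  have K0 : 0 ≤ K := by
    have : Nonempty Ω := nonempty_of_isProbabilityMeasure P
    exact (norm_nonneg _).trans (hK (Classical.arbitrary Ω))
  have T0 : 0 ≤ T := hs.trans hsT
  obtain ⟨C, hC0, hC⟩ := h.laplace_step hs hsT hl hZ hK
  set N : ℝ → Ω → ℂ := fun t ω => Complex.exp (-∫ r in Set.Ioc t T, (δ r : ℂ) * lapU l (T - r)) *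
    (Z ω * Complex.exp (-(lapU l (T - t) * (max (X t ω) 0 : ℝ)))) with hN
  have mZ : Measurable Z := (hZ.mono (ℱ.le s)).measurable
  have mN : ∀ t, Measurable (N t) := fun t => by
    have := h.meas t
    fun_prop
  have nN : ∀ t ω, s ≤ t → t ≤ T → ‖N t ω‖ ≤ K := by
    intro t ω ht htT
    have r1 : 0 ≤ (lapU l (T - t) * (max (X t ω) 0 : ℝ)).re := by
      rw [Complex.re_mul_ofReal]
      exact mul_nonneg (lapU_re hl (by linarith)) (le_max_right _ _)
    have r2 : 0 ≤ (∫ r in Set.Ioc t T, (δ r : ℂ) * lapU l (T - r)).re := h.q_re hl (hs.trans ht) le_rfl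
    simp only [hN, norm_mul]
    have a1 := norm_exp_neg_le r1
    have a2 := norm_exp_neg_le r2
    calc _ ≤ 1 * (K * 1) := by gcongr; exact hK ω
      _ = K := by ring
  have key := h.key_eq (N := N) hs hsT hC0 mN nN (by
    intro a b ha hab hbT A hA
    have mA : MeasurableSet A := ℱ.le a _ hA
    have iN : ∀ t, s ≤ t → t ≤ T → IntegrableOn (N t) A P := fun t h1 h2 =>
      (Integrable.of_bound (mN t).aestronglyMeasurable K
        (ae_of_all _ fun ω => nN t ω h1 h2)).integrableOn
    have e : ∀ t, ∫ ω in A, N t ω ∂P = Complex.exp (-∫ r in Set.Ioc t T, (δ r : ℂ) * lapU l (T - r)) *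
        ∫ ω, A.indicator Z ω * Complex.exp (-(lapU l (T - t) * (max (X t ω) 0 : ℝ))) ∂P := by
      intro t
      simp only [hN]
      rw [integral_const_mul, ← integral_indicator mA]
      congr 1
      refine integral_congr_ae (ae_of_all _ fun ω => ?_)
      by_cases hω : ω ∈ A <;> simp [hω]
    rw [integral_sub (iN b (ha.trans hab) hbT) (iN a ha (hab.trans hbT)), e, e]
    exact hC a b ha hab hbT A hA)
  simp only [hN] at key
  rw [integral_const_mul, integral_const_mul] at key
  simp only [Set.Ioc_self, Measure.restrict_empty, integral_zero_measure, neg_zero, Complex.exp_zero,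
    one_mul, sub_self, lapU_zero] at key
  rw [mul_comm]
  refine Eq.trans ?_ (key.trans ?_)
  · refine integral_congr_ae ?_
    filter_upwards [h.nonneg T0] with ω hω
    simp only [max_eq_left hω]
  · congr 1
    refine integral_congr_ae ?_
    filter_upwards [h.nonneg hs] with ω hω
    simp only [max_eq_left hω]

end GSol

namespace GSol

set_option linter.unusedSectionVars false

variable {Ω : Type*} [m : MeasurableSpace Ω] {P : Measure Ω} [IsProbabilityMeasure P]
  {ℱ : Filtration ℝ m} {δ : ℝ → ℝ} {x : ℝ} {X : ℝ → Ω → ℝ}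

lemma nonneg_all (h : GSol P ℱ δ x X) (r : ℝ) : ∀ᵐ ω ∂P, 0 ≤ X r ω := by
  rcases le_total 0 r with hr | hr
  · exact h.nonneg hr
  · filter_upwards [h.neg_time hr] with ω hω
    rw [hω]; exact h.x0

lemma max_time (h : GSol P ℱ δ x X) (r : ℝ) : ∀ᵐ ω ∂P, max (X r ω) 0 = X (max r 0) ω := by
  rcases le_total 0 r with hr | hr
  · filter_upwards [h.nonneg hr] with ω hω
    rw [max_eq_left hω, max_eq_left hr]
  · filter_upwards [h.neg_time hr] with ω hω
    rw [max_eq_right hr, h.init, hω, max_eq_left h.x0]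

/-- multi-time Laplace functional -/
def Fun (P : Measure Ω) (X : ℝ → Ω → ℝ) (lam : ℝ → ℂ) (I : Finset ℝ) (κ : ℂ) (s : ℝ) : ℂ :=
  ∫ ω, Complex.exp (-∑ r ∈ I, lam r * (max (X r ω) 0 : ℝ)) * Complex.exp (-(κ * (X s ω : ℝ))) ∂P

lemma sum_re {lam : ℝ → ℂ} (hlam : ∀ r, 0 ≤ (lam r).re) (I : Finset ℝ) (f : ℝ → ℝ) :
    0 ≤ (∑ r ∈ I, lam r * (max (f r) 0 : ℝ)).re := by
  rw [Complex.re_sum]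
  refine Finset.sum_nonneg fun r _ => ?_
  rw [Complex.re_mul_ofReal]
  exact mul_nonneg (hlam r) (le_max_right _ _)

lemma Fun_empty (h : GSol P ℱ δ x X) (lam : ℝ → ℂ) {κ : ℂ} (hκ : 0 ≤ κ.re) {s : ℝ} (hs : 0 ≤ s) :
    Fun P X lam ∅ κ s = Complex.exp (-(lapU κ s * x))
      * Complex.exp (-∫ r in Set.Ioc 0 s, (δ r : ℂ) * lapU κ (s - r)) := by
  have := h.laplace le_rfl hs hκ (Z := fun _ => 1) stronglyMeasurable_const (K := 1) (by simp)
  simp only [one_mul, h.init, sub_zero] at this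
  rw [integral_const] at this
  simpa [Fun] using this

lemma Fun_insert (h : GSol P ℱ δ x X) {lam : ℝ → ℂ} (hlam : ∀ r, 0 ≤ (lam r).re) {κ : ℂ}
    (hκ : 0 ≤ κ.re) {I : Finset ℝ} {a : ℝ} (hI : ∀ r ∈ I, r < a) {s : ℝ} (hs : 0 ≤ s) (has : a ≤ s) :
    Fun P X lam (insert a I) κ s = Fun P X lam I (lapU κ (s - max a 0) + lam a) (max a 0)
      * Complex.exp (-∫ r in Set.Ioc (max a 0) s, (δ r : ℂ) * lapU κ (s - r)) := by
  have haI : a ∉ I := fun h => lt_irrefl _ (hI a h)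
  have hm : ∀ r ∈ insert a I, r ≤ max a 0 := by
    intro r hr
    rcases Finset.mem_insert.1 hr with rfl | hr
    · exact le_max_left _ _
    · exact (hI r hr).le.trans (le_max_left _ _)
  have mZ : StronglyMeasurable[ℱ (max a 0)]
      (fun ω => Complex.exp (-∑ r ∈ insert a I, lam r * (max (X r ω) 0 : ℝ))) := by
    refine Measurable.stronglyMeasurable ?_
    refine Complex.measurable_exp.comp (Measurable.neg ?_)
    refine Finset.measurable_sum _ fun r hr => ?_
    have : Measurable[ℱ (max a 0)] (X r) := (h.adapted r).mono (ℱ.mono (hm r hr)) le_rfl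
    fun_prop
  have := h.laplace (le_max_right a 0) (max_le has hs) hκ mZ (K := 1)
    (fun ω => norm_exp_neg_le (sum_re hlam _ (fun r => X r ω)))
  unfold Fun
  rw [this]
  congr 1
  refine integral_congr_ae ?_
  filter_upwards [h.max_time a] with ω hω
  rw [Finset.sum_insert haI, hω, ← Complex.exp_add, ← Complex.exp_add]
  congr 1
  ring

end GSol

lemma Fun_mul {Ω₁ Ω₂ Ω₃ : Type*} [m₁ : MeasurableSpace Ω₁] [m₂ : MeasurableSpace Ω₂]
    [m₃ : MeasurableSpace Ω₃] {P₁ : Measure Ω₁} {P₂ : Measure Ω₂} {P₃ : Measure Ω₃}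
    [IsProbabilityMeasure P₁] [IsProbabilityMeasure P₂] [IsProbabilityMeasure P₃]
    {ℱ₁ : Filtration ℝ m₁} {ℱ₂ : Filtration ℝ m₂} {ℱ₃ : Filtration ℝ m₃}
    {δ δ' : ℝ → ℝ} {x y : ℝ} {X : ℝ → Ω₁ → ℝ} {Y : ℝ → Ω₂ → ℝ} {V : ℝ → Ω₃ → ℝ}
    (h₁ : GSol P₁ ℱ₁ δ x X) (h₂ : GSol P₂ ℱ₂ δ' y Y)
    (h₃ : GSol P₃ ℱ₃ (fun u => δ u + δ' u) (x + y) V)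
    {lam : ℝ → ℂ} (hlam : ∀ r, 0 ≤ (lam r).re) (I : Finset ℝ) :
    ∀ (κ : ℂ) (s : ℝ), 0 ≤ κ.re → 0 ≤ s → (∀ r ∈ I, r ≤ s) →
      GSol.Fun P₃ V lam I κ s = GSol.Fun P₁ X lam I κ s * GSol.Fun P₂ Y lam I κ s := by
  have q : ∀ (κ : ℂ) (a s : ℝ), 0 ≤ κ.re → 0 ≤ a →
      Complex.exp (-∫ r in Set.Ioc a s, ((δ r + δ' r : ℝ) : ℂ) * lapU κ (s - r))
      = Complex.exp (-∫ r in Set.Ioc a s, (δ r : ℂ) * lapU κ (s - r))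
        * Complex.exp (-∫ r in Set.Ioc a s, (δ' r : ℂ) * lapU κ (s - r)) := by
    intro κ a s hκ ha
    rw [← Complex.exp_add, ← neg_add, ← integral_add (h₁.q_int hκ ha le_rfl) (h₂.q_int hκ ha le_rfl)]
    simp only [Complex.ofReal_add, add_mul]
  induction I using Finset.induction_on_max with
  | empty =>
    intro κ s hκ hs _
    rw [h₁.Fun_empty lam hκ hs, h₂.Fun_empty lam hκ hs, h₃.Fun_empty lam hκ hs, q κ 0 s hκ le_rfl]
    have : Complex.exp (-(lapU κ s * ((x + y : ℝ) : ℂ)))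
        = Complex.exp (-(lapU κ s * x)) * Complex.exp (-(lapU κ s * y)) := by
      rw [← Complex.exp_add]; congr 1; push_cast; ring
    rw [this]; ring
  | insert a I hI ih =>
    intro κ s hκ hs hIs
    have has := hIs a (Finset.mem_insert_self _ _)
    have hre : 0 ≤ (lapU κ (s - max a 0) + lam a).re := by
      rw [Complex.add_re]
      exact add_nonneg (lapU_re hκ (by linarith [max_le has hs])) (hlam a)
    rw [h₁.Fun_insert hlam hκ hI hs has, h₂.Fun_insert hlam hκ hI hs has,
      h₃.Fun_insert hlam hκ hI hs has, q κ _ s hκ (le_max_right _ _),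
      ih _ _ hre (le_max_right _ _) (fun r hr => (hI r hr).le.trans (le_max_left _ _))]
    ring

lemma path_meas {Ω : Type*} [m : MeasurableSpace Ω] {X : ℝ → Ω → ℝ} (hX : ∀ t, Measurable (X t)) :
    Measurable (fun ω t => X t ω : Ω → RPath) := measurable_pi_lambda _ hX

lemma GSol.char_eq {Ω : Type*} [m : MeasurableSpace Ω] {P : Measure Ω} [IsProbabilityMeasure P]
    {ℱ : Filtration ℝ m} {δ : ℝ → ℝ} {x : ℝ} {X : ℝ → Ω → ℝ} (h : GSol P ℱ δ x X)
    (I : Finset ℝ) (ξ : ℝ → ℝ) (s : ℝ) :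
    ∫ f, Complex.exp ((∑ r ∈ I, ξ r * f r : ℝ) * Complex.I) ∂(pathLaw P X)
      = GSol.Fun P X (fun r => -(ξ r * Complex.I)) I 0 s := by
  unfold pathLaw GSol.Fun
  rw [integral_map (path_meas h.meas).aemeasurable
    (Measurable.aestronglyMeasurable (by fun_prop))]
  refine integral_congr_ae ?_
  have : ∀ᵐ ω ∂P, ∀ r ∈ I, 0 ≤ X r ω := (ae_ball_iff I.countable_toSet).2 fun r _ => h.nonneg_all r
  filter_upwards [this] with ω hω
  simp only [zero_mul, neg_zero, Complex.exp_zero, mul_one]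
  congr 1
  push_cast
  rw [Finset.sum_mul, ← Finset.sum_neg_distrib]
  refine Finset.sum_congr rfl fun r hr => ?_
  rw [max_eq_left (by exact_mod_cast hω r hr)]
  ring

lemma mconv_law {Ω₁ Ω₂ Ω₃ : Type*} [m₁ : MeasurableSpace Ω₁] [m₂ : MeasurableSpace Ω₂]
    [m₃ : MeasurableSpace Ω₃] {P₁ : Measure Ω₁} {P₂ : Measure Ω₂} {P₃ : Measure Ω₃}
    [IsProbabilityMeasure P₁] [IsProbabilityMeasure P₂] [IsProbabilityMeasure P₃]
    {ℱ₁ : Filtration ℝ m₁} {ℱ₂ : Filtration ℝ m₂} {ℱ₃ : Filtration ℝ m₃}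
    {δ δ' : ℝ → ℝ} {x y : ℝ} {X : ℝ → Ω₁ → ℝ} {Y : ℝ → Ω₂ → ℝ} {V : ℝ → Ω₃ → ℝ}
    (h₁ : GSol P₁ ℱ₁ δ x X) (h₂ : GSol P₂ ℱ₂ δ' y Y)
    (h₃ : GSol P₃ ℱ₃ (fun u => δ u + δ' u) (x + y) V) :
    mconv (pathLaw P₁ X) (pathLaw P₂ Y) = pathLaw P₃ V := by
  have : IsProbabilityMeasure (pathLaw P₁ X) :=
    Measure.isProbabilityMeasure_map (path_meas h₁.meas).aemeasurable
  have : IsProbabilityMeasure (pathLaw P₂ Y) :=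
    Measure.isProbabilityMeasure_map (path_meas h₂.meas).aemeasurable
  have : IsProbabilityMeasure (pathLaw P₃ V) :=
    Measure.isProbabilityMeasure_map (path_meas h₃.meas).aemeasurable
  have := isProbabilityMeasure_mconv (pathLaw P₁ X) (pathLaw P₂ Y)
  refine path_ext _ _ fun I ξ => ?_
  have hs : ∀ r ∈ I, r ≤ ∑ r ∈ I, |r| := fun r hr =>
    (le_abs_self r).trans (Finset.single_le_sum (f := fun r : ℝ => |r|) (fun i _ => abs_nonneg i) hr)
  rw [h₃.char_eq I ξ (∑ r ∈ I, |r|), Fun_mul h₁ h₂ h₃ (by simp) I 0 _ (by simp)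
    (Finset.sum_nonneg fun i _ => abs_nonneg i) hs, ← h₁.char_eq, ← h₂.char_eq,
    ← integral_prod_mul]
  unfold mconv
  have hadd : Measurable (fun p : RPath × RPath => p.1 + p.2) := measurable_fst.add measurable_snd
  rw [integral_map hadd.aemeasurable
    (Measurable.aestronglyMeasurable (by fun_prop))]
  refine integral_congr_ae (ae_of_all _ fun p => ?_)
  simp only [Pi.add_apply]
  rw [← Complex.exp_add, ← add_mul, ← Complex.ofReal_add, ← Finset.sum_add_distrib]
  simp only [mul_add]

lemma GSol.supp {Ω : Type*} [m : MeasurableSpace Ω] {P : Measure Ω} [IsProbabilityMeasure P]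
    {ℱ : Filtration ℝ m} {δ : ℝ → ℝ} {x : ℝ} {X : ℝ → Ω → ℝ} (h : GSol P ℱ δ x X)
    {t : ℝ} (ht : 0 < t) (ε : ℝ) (hε : 0 < ε) : 0 < (pathLaw P X) {f | f t ≤ ε} := by
  have mt : MeasurableSet {f : RPath | f t ≤ ε} := measurableSet_le (measurable_pi_apply t) measurable_const
  rw [pos_iff_ne_zero]
  intro h0
  unfold pathLaw at h0
  rw [Measure.map_apply (path_meas h.meas) mt] at h0
  have hX : ∀ᵐ ω ∂P, ε < X t ω := by
    rw [ae_iff]; simpa using h0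
  have main : ∀ n : ℕ, 1 ≤ n → ε ≤ x / (1 + 2 * n * t)
      + ∫ r in Set.Ioc 0 t, δ r / (1 + 2 * n * (t - r)) := by
    intro n hn
    have n0 : (0:ℝ) < n := by exact_mod_cast hn
    have lap : ∀ r : ℝ, lapU (n : ℂ) r = ((n / (1 + 2 * n * r) : ℝ) : ℂ) := fun r => by
      simp [lapU]
    have e := h.Fun_empty (fun _ => 0) (κ := (n : ℂ)) (by simp) ht.le
    have e1 : ∫ r in Set.Ioc 0 t, (δ r : ℂ) * lapU n (t - r)
        = ((n * ∫ r in Set.Ioc 0 t, δ r / (1 + 2 * n * (t - r)) : ℝ) : ℂ) := by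
      rw [← integral_const_mul, ← integral_complex_ofReal]
      refine integral_congr_ae (ae_of_all _ fun r => ?_)
      simp only [lap]
      push_cast
      ring
    rw [e1, lap, ← Complex.exp_add] at e
    have e2 : ‖GSol.Fun P X (fun _ => 0) ∅ n t‖ ≤ Real.exp (-(n * ε)) := by
      unfold GSol.Fun
      have := norm_integral_le_of_norm_le_const (μ := P) (C := Real.exp (-(n * ε)))
        (f := fun ω => Complex.exp (-∑ r ∈ (∅ : Finset ℝ), (0:ℂ) * (max (X r ω) 0 : ℝ)) *
          Complex.exp (-((n:ℂ) * (X t ω : ℝ)))) (by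
          filter_upwards [hX] with ω hω
          rw [norm_mul, Complex.norm_exp, Complex.norm_exp]
          simp
          gcongr)
      simpa using this
    rw [e, Complex.norm_exp, Real.exp_le_exp] at e2
    have e3 : (-(((n / (1 + 2 * n * t) : ℝ) : ℂ) * (x : ℂ)) +
        -((n * ∫ r in Set.Ioc 0 t, δ r / (1 + 2 * n * (t - r)) : ℝ) : ℂ)).re
        = -(n * (x / (1 + 2 * n * t) + ∫ r in Set.Ioc 0 t, δ r / (1 + 2 * n * (t - r)))) := by
      rw [← Complex.ofReal_mul, ← Complex.ofReal_neg, ← Complex.ofReal_neg, ← Complex.ofReal_add,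
        Complex.ofReal_re]
      ring
    rw [e3] at e2
    exact le_of_mul_le_mul_left (neg_le_neg_iff.1 e2) n0
  have den : ∀ c : ℝ, 0 < c → Tendsto (fun n : ℕ => 1 + 2 * (n:ℝ) * c) atTop atTop := by
    intro c hc
    refine tendsto_atTop_add_const_left _ _ ?_
    exact (tendsto_natCast_atTop_atTop.const_mul_atTop (by norm_num : (0:ℝ) < 2)).atTop_mul_const hc
  have l1 : Tendsto (fun n : ℕ => x / (1 + 2 * (n:ℝ) * t)) atTop (nhds 0) :=
    (den t ht).const_div_atTop x
  have l2 : Tendsto (fun n : ℕ => ∫ r in Set.Ioc 0 t, δ r / (1 + 2 * (n:ℝ) * (t - r))) atTop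
      (nhds (∫ r in Set.Ioc (0:ℝ) t, (0:ℝ))) := by
    refine tendsto_integral_of_dominated_convergence δ (fun n => ?_) (h.d_int le_rfl) (fun n => ?_) ?_
    · have := h.dm
      exact Measurable.aestronglyMeasurable (by fun_prop)
    · refine (ae_restrict_iff' measurableSet_Ioc).2 (ae_of_all _ fun r hr => ?_)
      have : 0 ≤ 2 * (n:ℝ) * (t - r) := mul_nonneg (by positivity) (by linarith [hr.2])
      rw [Real.norm_of_nonneg (div_nonneg (h.d0 r) (by linarith))]
      exact div_le_self (h.d0 r) (by linarith)
    · have : ∀ᵐ r : ℝ, r ≠ t := by simp [ae_iff]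
      refine (ae_restrict_iff' measurableSet_Ioc).2 ?_
      filter_upwards [this] with r hrt hr
      exact (den (t - r) (by linarith [lt_of_le_of_ne hr.2 hrt])).const_div_atTop _
  have l3 := l1.add l2
  simp only [integral_zero, add_zero] at l3
  have := ge_of_tendsto l3 (eventually_atTop.2 ⟨1, main⟩)
  linarith

lemma GSol.pos_law {Ω : Type*} [m : MeasurableSpace Ω] {P : Measure Ω} [IsProbabilityMeasure P]
    {ℱ : Filtration ℝ m} {δ : ℝ → ℝ} {x : ℝ} {X : ℝ → Ω → ℝ} (h : GSol P ℱ δ x X)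
    (t : ℝ) : ∀ᵐ f ∂(pathLaw P X), 0 ≤ f t := by
  unfold pathLaw
  rw [ae_map_iff (path_meas h.meas).aemeasurable
    (measurableSet_le measurable_const (measurable_pi_apply t))]
  exact h.nonneg_all t

lemma MemD.add {f g : ℝ → ℝ} (hf : MemD f) (hg : MemD g) : MemD (fun u => f u + g u) := by
  obtain ⟨f1, f2, f3, S, f4, f5⟩ := hf
  obtain ⟨g1, g2, g3, S', g4, g5⟩ := hg
  refine ⟨f1.add g1, fun t => add_nonneg (f2 t) (g2 t), fun T => ?_, S ∪ S', f4.union g4, fun t ht => ?_⟩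
  · obtain ⟨C, hC⟩ := f3 T
    obtain ⟨D, hD⟩ := g3 T
    exact ⟨C + D, fun t ht => add_le_add (hC t ht) (hD t ht)⟩
  · exact (f5 t fun h => ht (Or.inl h)).add (g5 t fun h => ht (Or.inr h))

/-- Bridge additivity: `Q^{δ,t}_{x→0} ⊕ Q^{δ',t}_{y→0} = Q^{δ+δ',t}_{x+y→0}`. -/
theorem gbesq_bridge_additivity (δ δ' : ℝ → ℝ) (hδ : MemD δ) (hδ' : MemD δ')
    (t x y : ℝ) (ht : 0 < t) (hx : 0 ≤ x) (hy : 0 ≤ y)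
    (ρ₁ ρ₂ ρ₃ : Measure RPath)
    (h₁ : IsGBESQBridge δ t x 0 ρ₁) (h₂ : IsGBESQBridge δ' t y 0 ρ₂)
    (h₃ : IsGBESQBridge (fun u => δ u + δ' u) t (x + y) 0 ρ₃) :
    mconv ρ₁ ρ₂ = ρ₃ := by
  obtain ⟨μ₁, Q₁, ⟨R₁⟩, hQ₁, rfl⟩ := h₁
  obtain ⟨μ₂, Q₂, ⟨R₂⟩, hQ₂, rfl⟩ := h₂
  obtain ⟨μ₃, Q₃, ⟨R₃⟩, hQ₃, rfl⟩ := h₃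
  obtain ⟨Ω₁, P₁, ℱ₁, W₁, X₁, p₁, b₁, s₁, rfl⟩ := R₁
  obtain ⟨Ω₂, P₂, ℱ₂, W₂, X₂, p₂, b₂, s₂, rfl⟩ := R₂
  obtain ⟨Ω₃, P₃, ℱ₃, W₃, X₃, p₃, b₃, s₃, rfl⟩ := R₃
  have g₁ := s₁.gsol hδ hx
  have g₂ := s₂.gsol hδ' hy
  have g₃ := s₃.gsol (hδ.add hδ') (add_nonneg hx hy)
  have : IsProbabilityMeasure (pathLaw P₁ X₁) :=
    Measure.isProbabilityMeasure_map (path_meas g₁.meas).aemeasurable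
  have : IsProbabilityMeasure (pathLaw P₂ X₂) :=
    Measure.isProbabilityMeasure_map (path_meas g₂.meas).aemeasurable
  have : IsProbabilityMeasure (pathLaw P₃ X₃) :=
    Measure.isProbabilityMeasure_map (path_meas g₃.meas).aemeasurable
  exact bridge_combine hQ₁ hQ₂ hQ₃ (g₁.pos_law t) (g₂.pos_law t) (g₃.pos_law t)
    (mconv_law g₁ g₂ g₃) (fun ε hε => g₃.supp ht ε hε)
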